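/- arXiv:2006.02202 — 7 statements merged into one kernel-verified Lean document; each statement's English description precedes it below -/
import Mathlib

section
/- Fix an integer N ≥ 2. For every regular linear transformation T = [c_{m,n}], the set R_T of points x ∈ [0,1] such that the set of accumulation points (with respect to the ℓ¹ norm) of the T-averaged digit-frequency sequence (Π^T(x,m))_m contains every point of the simplex Δ_N is residual (comeager) in [0,1]. -/
open Filter Topology

/-- The `j`-th digit (for `j ≥ 1`) of the unique non-terminating base-`N` expansion
of `x ∈ [0,1]`. -/
noncomputable def digit (N : ℕ) (x : ℝ) (j : ℕ) : ℕ :=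
  (⌈(N : ℝ) ^ j * x⌉ - (N : ℤ) * ⌈(N : ℝ) ^ (j - 1) * x⌉ + (N : ℤ) - 1).toNat

/-- `freqVec N x n i = Π_i(x,n)`, the frequency of digit `i` among the first `n` digits. -/
noncomputable def freqVec (N : ℕ) (x : ℝ) (n : ℕ) : Fin N → ℝ :=
  fun i => (((Finset.Icc 1 n).filter (fun j => digit N x j = i.val)).card : ℝ) / n

/-- `p` is an accumulation point of the sequence `v` w.r.t. the ℓ¹ norm. -/
def IsAccPt1 (N : ℕ) (v : ℕ → Fin N → ℝ) (p : Fin N → ℝ) : Prop :=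
  ∃ φ : ℕ → ℕ, StrictMono φ ∧
    Tendsto (fun u => ∑ k, |v (φ u) k - p k|) atTop (𝓝 0)

/-- The series `Σ f n` converges (in the classical sense) to `t`. -/
def SeriesTo (f : ℕ → ℝ) (t : ℝ) : Prop :=
  Tendsto (fun K => ∑ n ∈ Finset.range K, f n) atTop (𝓝 t)

/-- `c` is a linear transformation: the series `Σ_n c m n * s n` converges for every
convergent sequence `s` and every row `m`. -/
def IsLinTrans (c : ℕ → ℕ → ℝ) : Prop :=
  ∀ s : ℕ → ℝ, (∃ l, Tendsto s atTop (𝓝 l)) → ∀ m, ∃ t, SeriesTo (fun n => c m n * s n) t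

/-- `c` is a regular linear transformation: moreover, the averaged sequence converges to
the same limit. -/
def IsRegularLT (c : ℕ → ℕ → ℝ) : Prop :=
  IsLinTrans c ∧
    ∀ (s : ℕ → ℝ) (l : ℝ), Tendsto s atTop (𝓝 l) →
      ∀ t : ℕ → ℝ, (∀ m, SeriesTo (fun n => c m n * s n) (t m)) →
        Tendsto t atTop (𝓝 l)

/-- The `T`-averaged digit frequency vector `Π^T(x,m)`. -/
noncomputable def freqT (N : ℕ) (c : ℕ → ℕ → ℝ) (x : ℝ) (m : ℕ) : Fin N → ℝ :=
  fun i => ∑' n, c m n * freqVec N x n i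

/-- `𝔻`: rational probability vectors except `(1,0,...,0)` and `(0,...,0,1)`. -/
def Dset (N : ℕ) : Set (Fin N → ℝ) :=
  {q | q ∈ stdSimplex ℝ (Fin N) ∧ (∀ i, ∃ r : ℚ, q i = (r : ℝ)) ∧
    q ≠ (fun i => if i.val = 0 then 1 else 0) ∧
    q ≠ (fun i => if i.val = N - 1 then 1 else 0)}

/-- `𝕀`: points of `[0,1]` with non-terminating base-`N` expansion. -/
def Iset (N : ℕ) : Set ℝ :=
  {x | x ∈ Set.Icc (0 : ℝ) 1 ∧ ¬∃ n k : ℕ, k < N ^ n ∧ x = (k : ℝ) / (N : ℝ) ^ n}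

/-- Property `P_{h,ψ}` of a sequence in `ℝ^N`. -/
def PropP (N h : ℕ) (ψ : ℕ → ℕ) (v : ℕ → Fin N → ℝ) : Prop :=
  ∀ i m : ℕ, ∀ q ∈ Dset N, ∃ j : ℕ, i ≤ j ∧ (j : ℝ) / (ψ j : ℝ) ≤ 1 / (h : ℝ) ∧
    ∀ n : ℕ, j ≤ n → n ≤ ψ^[m] j → ∑ k, |v n k - q k| < 1 / (h : ℝ)

/-- Number of grid intervals of length `1/n` meeting `E`. -/
noncomputable def boxCount (E : Set ℝ) (n : ℕ) : ℕ∞ :=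
  {k : ℤ | (E ∩ Set.Ico ((k : ℝ) / n) (((k : ℝ) + 1) / n)).Nonempty}.encard

/-- Upper box (Minkowski) dimension of a subset of `ℝ`. -/
noncomputable def upperBoxDim (E : Set ℝ) : EReal :=
  Filter.limsup (fun n : ℕ =>
    if boxCount E n = ⊤ then (⊤ : EReal)
    else ((Real.log (boxCount E n).toNat / Real.log n : ℝ) : EReal)) Filter.atTop

/-- Packing dimension of a subset of `ℝ`, via countable covers:
`dim_P F = inf { sup_n upperBoxDim (E n) : F ⊆ ⋃ n, E n }`. -/
noncomputable def packingDim (F : Set ℝ) : EReal :=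
  sInf ((fun E : ℕ → Set ℝ => ⨆ n, upperBoxDim (E n)) '' {E | F ⊆ ⋃ n, E n})

theorem summable_abs_of_forall_seriesTo {c : ℕ → ℝ}
    (h : ∀ s : ℕ → ℝ, Tendsto s atTop (𝓝 0) → ∃ t, SeriesTo (fun n => c n * s n) t) :
    Summable fun n => |c n| := by
  by_contra hns
  set P : ℕ → ℝ := fun K => ∑ k ∈ Finset.range K, |c k| with hP
  have hPtop : Tendsto P atTop atTop :=
    (not_summable_iff_tendsto_nat_atTop_of_nonneg fun n => abs_nonneg (c n)).1 hns
  have hP0 : ∀ K, 0 ≤ P K := fun K => Finset.sum_nonneg fun k _ => abs_nonneg (c k)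
  set r : ℕ → ℝ := fun K => √(1 + P K) with hr
  have hrpos : ∀ K, 0 < r K := fun K => Real.sqrt_pos.2 (by linarith [hP0 K])
  have hrsq : ∀ K, r K * r K = 1 + P K := fun K => Real.mul_self_sqrt (by linarith [hP0 K])
  have hrtop : Tendsto r atTop atTop :=
    Real.tendsto_sqrt_atTop.comp (tendsto_atTop_add_const_left _ 1 hPtop)
  have hs : Tendsto (fun k => (SignType.sign (c k) : ℝ) * (r (k + 1))⁻¹) atTop (𝓝 0) := by
    refine squeeze_zero_norm (fun k => ?_)
      (hrtop.comp (tendsto_add_atTop_nat 1)).inv_tendsto_atTop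
    have hsign : |(SignType.sign (c k) : ℝ)| ≤ 1 := by
      rcases lt_trichotomy (c k) 0 with hk | hk | hk <;> simp [hk]
    rw [Real.norm_eq_abs, abs_mul, abs_of_pos (inv_pos.2 (hrpos _))]
    exact mul_le_of_le_one_left (inv_pos.2 (hrpos _)).le hsign
  obtain ⟨t, ht⟩ := h _ hs
  refine not_tendsto_nhds_of_tendsto_atTop ?_ t ht
  refine tendsto_atTop_mono (fun K => ?_) (tendsto_atTop_add_const_right _ (-r 0) hrtop)
  rw [← sub_eq_add_neg, ← Finset.sum_range_sub]
  refine Finset.sum_le_sum fun k _ => ?_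
  rw [← mul_assoc, self_mul_sign, ← div_eq_mul_inv, le_div_iff₀ (hrpos _)]
  have hstep : P (k + 1) = P k + |c k| := Finset.sum_range_succ _ _
  nlinarith [hrsq k, hrsq (k + 1), sq_nonneg (r (k + 1) - r k), hrpos k, hrpos (k + 1),
    Real.sqrt_le_sqrt (show 1 + P k ≤ 1 + P (k + 1) by linarith [abs_nonneg (c k)])]

theorem IsLinTrans.summable_abs {c : ℕ → ℕ → ℝ} (hc : IsLinTrans c) (m : ℕ) :
    Summable fun n => |c m n| :=
  summable_abs_of_forall_seriesTo fun s hs => hc s ⟨0, hs⟩ m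

theorem abs_freqVec_le_one (N : ℕ) (x : ℝ) (n : ℕ) (i : Fin N) : |freqVec N x n i| ≤ 1 := by
  have hcard : (((Finset.Icc 1 n).filter (fun j => digit N x j = i.val)).card : ℝ) ≤ n := by
    exact_mod_cast (Finset.card_filter_le _ _).trans (by simp)
  rw [freqVec, abs_of_nonneg (by positivity)]
  exact div_le_one_of_le₀ hcard (by positivity)

theorem abs_mul_freqVec_le (N : ℕ) (a x : ℝ) (n : ℕ) (i : Fin N) :
    |a * freqVec N x n i| ≤ |a| := by
  rw [abs_mul]
  exact mul_le_of_le_one_right (abs_nonneg _) (abs_freqVec_le_one N x n i)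

theorem eventually_ceil_eq_nhdsLE (N j : ℕ) (x : ℝ) :
    ∀ᶠ y in 𝓝[≤] x, ⌈(N : ℝ) ^ j * y⌉ = ⌈(N : ℝ) ^ j * x⌉ := by
  have hcont : Continuous fun y : ℝ => (N : ℝ) ^ j * y := by fun_prop
  have hlt : ∀ᶠ y in 𝓝[≤] x, (⌈(N : ℝ) ^ j * x⌉ : ℝ) - 1 < (N : ℝ) ^ j * y :=
    nhdsWithin_le_nhds <| hcont.continuousAt.eventually_const_lt
      (by linarith [Int.ceil_lt_add_one ((N : ℝ) ^ j * x)])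
  filter_upwards [hlt, self_mem_nhdsWithin] with y hy hyx
  refine Int.ceil_eq_iff.2 ⟨hy, ?_⟩
  have hyx' : y ≤ x := hyx
  exact (mul_le_mul_of_nonneg_left hyx' (by positivity)).trans (Int.le_ceil _)

theorem eventually_digit_eq_nhdsLE (N j : ℕ) (x : ℝ) :
    ∀ᶠ y in 𝓝[≤] x, digit N y j = digit N x j := by
  filter_upwards [eventually_ceil_eq_nhdsLE N j x, eventually_ceil_eq_nhdsLE N (j - 1) x]
    with y h1 h2
  rw [digit, digit, h1, h2]

theorem eventually_freqVec_eq_nhdsLE (N n : ℕ) (x : ℝ) :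
    ∀ᶠ y in 𝓝[≤] x, freqVec N y n = freqVec N x n := by
  have hall : ∀ᶠ y in 𝓝[≤] x, ∀ j ∈ Finset.Icc 1 n, digit N y j = digit N x j :=
    (Filter.eventually_all_finset _).2 fun j _ => eventually_digit_eq_nhdsLE N j x
  filter_upwards [hall] with y hy
  funext i
  rw [freqVec, freqVec, Finset.filter_congr fun j hj => by rw [hy j hj]]

theorem tendsto_freqT_nhdsLE (N : ℕ) {c : ℕ → ℕ → ℝ} (hc : IsLinTrans c) (m : ℕ) (i : Fin N)
    (x : ℝ) : Tendsto (fun y => freqT N c y m i) (𝓝[≤] x) (𝓝 (freqT N c x m i)) := by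
  refine tendsto_tsum_of_dominated_convergence (hc.summable_abs m) (fun n => ?_)
    (Eventually.of_forall fun y n => abs_mul_freqVec_le N _ y n i)
  refine tendsto_const_nhds.congr' ?_
  filter_upwards [eventually_freqVec_eq_nhdsLE N n x] with y hy
  rw [hy]

theorem IsRegularLT.tendsto_freqT {N : ℕ} {c : ℕ → ℕ → ℝ} (hc : IsRegularLT c) {x : ℝ}
    {i : Fin N} {l : ℝ} (h : Tendsto (fun n => freqVec N x n i) atTop (𝓝 l)) :
    Tendsto (fun m => freqT N c x m i) atTop (𝓝 l) := by
  refine hc.2 _ l h _ fun m => ?_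
  have hsum : Summable fun n => c m n * freqVec N x n i :=
    Summable.of_norm_bounded (hc.1.summable_abs m) fun n => abs_mul_freqVec_le N _ x n i
  exact hsum.hasSum.tendsto_sum_nat

theorem tendsto_div_of_add_eq {f : ℕ → ℝ} {A L : ℕ} {s : ℝ} (hA : 0 < A)
    (h : ∀ n, L ≤ n → f (n + A) = f n + s) :
    Tendsto (fun n => f n / n) atTop (𝓝 (s / A)) := by
  set g : ℕ → ℝ := fun n => f (n + L) - (n + L) * (s / A) with hg
  have hA' : (A : ℝ) ≠ 0 := by positivity
  have hper : Function.Periodic g A := fun n => by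
    have hn := h (n + L) (by omega)
    simp only [hg]
    rw [show n + A + L = n + L + A by ring, hn]
    push_cast
    field_simp
    ring
  set B : ℝ := ∑ k ∈ Finset.range A, |g k|
  have hB : ∀ n, |g n| ≤ B := fun n => by
    rw [← hper.map_mod_nat n]
    exact Finset.single_le_sum (f := fun k => |g k|) (fun k _ => abs_nonneg _)
      (Finset.mem_range.2 (Nat.mod_lt n hA))
  rw [tendsto_iff_norm_sub_tendsto_zero]
  refine squeeze_zero' (Eventually.of_forall fun n => norm_nonneg _) ?_
    (tendsto_const_div_atTop_nhds_zero_nat B)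
  filter_upwards [eventually_ge_atTop L, eventually_gt_atTop 0] with n hn hn0
  have hn0' : (0 : ℝ) < n := by exact_mod_cast hn0
  have heq : f n / n - s / A = g (n - L) / n := by
    simp only [hg, Nat.sub_add_cancel hn, Nat.cast_sub hn]
    field_simp
    ring
  rw [heq, Real.norm_eq_abs, abs_div, abs_of_pos hn0']
  exact div_le_div_of_nonneg_right (hB _) hn0'.le

theorem ofDigits_pos {N : ℕ} {d : ℕ → Fin N} {k : ℕ} (hk : (d k : ℕ) ≠ 0) :
    0 < Real.ofDigits d := by
  refine Real.summable_ofDigitsTerm.tsum_pos (fun _ => Real.ofDigitsTerm_nonneg) k ?_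
  have hd : (0 : ℝ) < (d k : ℕ) := by exact_mod_cast Nat.pos_of_ne_zero hk
  have hN : (0 : ℝ) < N := by exact_mod_cast Fin.pos (d k)
  simp only [Real.ofDigitsTerm]
  positivity

theorem digit_of_scaled_eq_ofDigits {N : ℕ} (hN : 2 ≤ N) {d : ℕ → Fin N}
    (hd : ∀ j, ∃ k, j ≤ k ∧ (d k : ℕ) ≠ 0) {x : ℝ} {L : ℕ} {k : ℤ}
    (hx : (N : ℝ) ^ L * x = k + Real.ofDigits d) (j : ℕ) : digit N x (L + j + 1) = d j := by
  have hN0 : (0 : ℝ) < N := by positivity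
  set y : ℕ → ℝ := fun j => Real.ofDigits fun n => d (n + j) with hy
  have hstep : ∀ j, (N : ℝ) * y j = d j + y (j + 1) := fun j => by
    have := Real.ofDigits_eq_sum_add_ofDigits (fun n => d (n + j)) 1
    simp only [hy]
    rw [this]
    simp only [Finset.range_one, Finset.sum_singleton, Real.ofDigitsTerm, zero_add, pow_one]
    rw [show (fun i => d (i + 1 + j)) = fun n => d (n + (j + 1)) by
      funext n; congr 1; ring]
    field_simp
  have hpos : ∀ j, 0 < y j := fun j => by
    obtain ⟨k, hjk, hk⟩ := hd j
    exact ofDigits_pos (k := k - j) (by simpa only [Nat.sub_add_cancel hjk] using hk)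
  have hle : ∀ j, y j ≤ 1 := fun j => Real.ofDigits_le_one _
  have hint : ∀ j, ∃ z : ℤ, (N : ℝ) ^ (L + j) * x = z + y j := fun j => by
    induction j with
    | zero => exact ⟨k, hx⟩
    | succ j ih =>
      obtain ⟨z, hz⟩ := ih
      refine ⟨N * z + (d j : ℕ), ?_⟩
      rw [← add_assoc, pow_succ', mul_assoc, hz, mul_add, hstep]
      push_cast
      ring
  obtain ⟨z, hz⟩ := hint j
  have h1 : ⌈(N : ℝ) ^ (L + j) * x⌉ = z + 1 := by
    rw [hz, Int.ceil_eq_iff]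
    push_cast
    constructor <;> linarith [hpos j, hle j]
  have h2 : ⌈(N : ℝ) ^ (L + j + 1) * x⌉ = N * z + (d j : ℕ) + 1 := by
    rw [pow_succ', mul_assoc, hz, mul_add, hstep, Int.ceil_eq_iff]
    push_cast
    constructor <;> linarith [hpos (j + 1), hle (j + 1)]
  rw [digit, Nat.add_sub_cancel, h1, h2]
  have : (N * z + (d j : ℕ) + 1 - (N : ℤ) * (z + 1) + N - 1 : ℤ) = (d j : ℕ) := by ring
  rw [this, Int.toNat_natCast]

theorem exists_periodic_count_eq {N : ℕ} (a : Fin N → ℕ) (ha : 0 < ∑ i, a i) :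
    ∃ d : ℕ → Fin N, Function.Periodic d (∑ i, a i) ∧
      ∀ i, Nat.count (fun j => d j = i) (∑ i, a i) = a i := by
  set A := ∑ i, a i with hA
  refine ⟨fun j => (finSigmaFinEquiv.symm ⟨j % A, Nat.mod_lt j ha⟩).1, fun j => by simp,
    fun i => ?_⟩
  rw [Nat.count_eq_card_filter_range, ← Finset.card_fin (a i)]
  symm
  refine Finset.card_bij (fun k _ => (finSigmaFinEquiv ⟨i, k⟩ : ℕ)) (fun k _ => ?_)
    (fun k _ l _ hkl => ?_) (fun j hj => ?_)
  · have hlt := (finSigmaFinEquiv (⟨i, k⟩ : (i : Fin N) × Fin (a i))).isLt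
    simp only [Finset.mem_filter, Finset.mem_range]
    refine ⟨hlt, ?_⟩
    simp only [hA, Nat.mod_eq_of_lt hlt, Fin.eta, Equiv.symm_apply_apply]
  · simpa using finSigmaFinEquiv.injective (Fin.ext hkl)
  · simp only [Finset.mem_filter, Finset.mem_range] at hj
    obtain ⟨hj, hji⟩ := hj
    subst hji
    refine ⟨(finSigmaFinEquiv.symm ⟨j % A, Nat.mod_lt j ha⟩).2, Finset.mem_univ _, ?_⟩
    simp [Nat.mod_eq_of_lt hj]

theorem exists_mem_Ioo_tendsto_freqVec {N : ℕ} (hN : 2 ≤ N) {a : Fin N → ℕ} (ha : ∀ i, 0 < a i)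
    {u v : ℝ} (huv : u < v) :
    ∃ x ∈ Set.Ioo u v, ∀ i,
      Tendsto (fun n => freqVec N x n i) atTop (𝓝 (a i / (∑ k, a k : ℕ))) := by
  have hA : 0 < ∑ i, a i :=
    Finset.sum_pos (fun i _ => ha i) ⟨⟨0, by omega⟩, Finset.mem_univ _⟩
  obtain ⟨d, hper, hcount⟩ := exists_periodic_count_eq a hA
  set A := ∑ i, a i
  have hd : ∀ j, ∃ k, j ≤ k ∧ (d k : ℕ) ≠ 0 := fun j => by
    have hpos : 0 < Nat.count (fun j => d j = ⟨1, hN⟩) A := by rw [hcount]; exact ha _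
    rw [Nat.count_eq_card_filter_range, Finset.card_pos] at hpos
    obtain ⟨k, hk⟩ := hpos
    refine ⟨k + j * A, by nlinarith, ?_⟩
    have hk' : d (k + j * A) = d k := by simpa using hper.nat_mul j k
    rw [hk', (Finset.mem_filter.1 hk).2]
    exact one_ne_zero
  have hypos : 0 < Real.ofDigits d := by
    obtain ⟨k, -, hk⟩ := hd 0
    exact ofDigits_pos hk
  obtain ⟨L, hL⟩ := pow_unbounded_of_one_lt (2 / (v - u))
    (show (1 : ℝ) < N by exact_mod_cast hN)
  have hNL : (0 : ℝ) < (N : ℝ) ^ L := by positivity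
  rw [div_lt_iff₀ (sub_pos.2 huv)] at hL
  set k : ℤ := ⌈(N : ℝ) ^ L * u⌉
  refine ⟨(k + Real.ofDigits d) / (N : ℝ) ^ L, ⟨?_, ?_⟩, fun i => ?_⟩
  · rw [lt_div_iff₀ hNL]
    linarith [Int.le_ceil ((N : ℝ) ^ L * u)]
  · rw [div_lt_iff₀ hNL]
    linarith [Int.ceil_lt_add_one ((N : ℝ) ^ L * u), Real.ofDigits_le_one d]
  set x := (k + Real.ofDigits d) / (N : ℝ) ^ L with hx
  have hdig : ∀ j, digit N x (L + j + 1) = d j :=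
    digit_of_scaled_eq_ofDigits hN hd (k := k) (by rw [hx]; field_simp)
  refine tendsto_div_of_add_eq (L := L)
    (f := fun n => (((Finset.Icc 1 n).filter (fun j => digit N x j = i.val)).card : ℝ))
    hA fun n hn => ?_
  have hsplit : Finset.Icc 1 (n + A) =
      Finset.Icc 1 n ∪ (Finset.Ico (n - L) (n - L + A)).map (addRightEmbedding (L + 1)) := by
    rw [Finset.map_add_right_Ico]
    ext j
    simp only [Finset.mem_union, Finset.mem_Icc, Finset.mem_Ico]
    omega
  have hdisj : Disjoint (Finset.Icc 1 n)
      ((Finset.Ico (n - L) (n - L + A)).map (addRightEmbedding (L + 1))) := by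
    rw [Finset.map_add_right_Ico, Finset.disjoint_left]
    intro j
    simp only [Finset.mem_Icc, Finset.mem_Ico]
    omega
  rw [hsplit, Finset.filter_union, Finset.card_union_of_disjoint
    (Finset.disjoint_filter_filter hdisj), Finset.filter_map, Finset.card_map]
  have hcongr : (Finset.Ico (n - L) (n - L + A)).filter
      ((fun j => digit N x j = i.val) ∘ addRightEmbedding (L + 1)) =
      (Finset.Ico (n - L) (n - L + A)).filter fun j => d j = i := by
    refine Finset.filter_congr fun j _ => ?_
    simp only [Function.comp_apply, addRightEmbedding_apply]
    rw [show j + (L + 1) = L + j + 1 by ring, hdig, Fin.ext_iff]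
  rw [hcongr, Nat.filter_Ico_card_eq_of_periodic _ _ _ (fun j => by rw [hper j]), hcount]
  push_cast
  rfl

/-- The reals at which, stably under small perturbations, some `T`-averaged frequency vector of
index at least `M` is within `1 / (h + 1)` of the probability vector proportional to `a`. -/
def freqApproxSet (N : ℕ) (c : ℕ → ℕ → ℝ) (a : Fin N → ℕ) (h M : ℕ) : Set ℝ :=
  interior {x | ∃ m, M ≤ m ∧ ∑ i, |freqT N c x m i - a i / (∑ k, a k : ℕ)| < 1 / ((h : ℝ) + 1)}

theorem dense_freqApproxSet {N : ℕ} (hN : 2 ≤ N) {c : ℕ → ℕ → ℝ} (hc : IsRegularLT c)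
    {a : Fin N → ℕ} (ha : ∀ i, 0 < a i) (h M : ℕ) : Dense (freqApproxSet N c a h M) := by
  refine dense_of_exists_between fun {u v} huv => ?_
  obtain ⟨x, ⟨hux, hxv⟩, hx⟩ := exists_mem_Ioo_tendsto_freqVec hN ha huv
  have hlim : Tendsto (fun m => ∑ i, |freqT N c x m i - a i / (∑ k, a k : ℕ)|) atTop (𝓝 0) := by
    simpa using tendsto_finsetSum Finset.univ fun i _ =>
      ((hc.tendsto_freqT (hx i)).sub_const (a i / (∑ k, a k : ℕ) : ℝ)).abs
  obtain ⟨m, hm, hMm⟩ := ((hlim.eventually_lt_const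
    (show (0 : ℝ) < 1 / ((h : ℝ) + 1) by positivity)).and (eventually_ge_atTop M)).exists
  have hleft : Tendsto (fun y => ∑ i, |freqT N c y m i - a i / (∑ k, a k : ℕ)|) (𝓝[≤] x)
      (𝓝 (∑ i, |freqT N c x m i - a i / (∑ k, a k : ℕ)|)) :=
    tendsto_finsetSum _ fun i _ => ((tendsto_freqT_nhdsLE N hc.1 m i x).sub_const _).abs
  obtain ⟨w, hw, hwx⟩ := (mem_nhdsLE_iff_exists_Ioc_subset' hux).1
    (hleft.eventually_lt_const hm)
  obtain ⟨y, hy1, hy2⟩ := exists_between (max_lt hux hw)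
  refine ⟨y, ?_, (le_max_left _ _).trans_lt hy1, hy2.trans hxv⟩
  refine mem_interior.2 ⟨Set.Ioo w x, fun z hz => ⟨m, hMm, hwx ⟨hz.1, hz.2.le⟩⟩, isOpen_Ioo,
    (le_max_right _ _).trans_lt hy1, hy2⟩

theorem exists_pos_sum_abs_sub_lt {N : ℕ} {p : Fin N → ℝ} (hp : p ∈ stdSimplex ℝ (Fin N))
    {ε : ℝ} (hε : 0 < ε) :
    ∃ a : Fin N → ℕ, (∀ i, 0 < a i) ∧ ∑ i, |(a i / (∑ k, a k : ℕ) : ℝ) - p i| < ε := by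
  set a : ℕ → Fin N → ℕ := fun n i => ⌊p i * n⌋₊ + 1
  have h1 : ∀ i, Tendsto (fun n : ℕ => (a n i : ℝ) / n) atTop (𝓝 (p i)) := fun i => by
    have := ((tendsto_nat_floor_mul_div_atTop (hp.1 i)).comp
      (tendsto_natCast_atTop_atTop (R := ℝ))).add (tendsto_const_div_atTop_nhds_zero_nat 1)
    simpa [a, add_div] using this
  have h2 : Tendsto (fun n : ℕ => ∑ i, (a n i : ℝ) / n) atTop (𝓝 1) := by
    rw [← hp.2]
    exact tendsto_finsetSum _ fun i _ => h1 i
  have h3 : ∀ i, Tendsto (fun n : ℕ => (a n i / (∑ k, a n k : ℕ) : ℝ)) atTop (𝓝 (p i)) :=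
    fun i => by
      have := (h1 i).div h2 one_ne_zero
      rw [div_one] at this
      refine this.congr' ?_
      filter_upwards [eventually_gt_atTop 0] with n hn
      have hn' : (n : ℝ) ≠ 0 := by positivity
      simp only [Pi.div_apply]
      rw [← Finset.sum_div, div_div_div_cancel_right₀ hn']
      push_cast
      rfl
  have h4 : Tendsto (fun n : ℕ => ∑ i, |(a n i / (∑ k, a n k : ℕ) : ℝ) - p i|) atTop (𝓝 0) := by
    simpa using tendsto_finsetSum Finset.univ fun i _ => ((h3 i).sub_const (p i)).abs
  obtain ⟨n, hn⟩ := (h4.eventually_lt_const hε).exists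
  exact ⟨a n, fun i => Nat.succ_pos _, hn⟩

theorem isAccPt1_of_forall_exists_lt {N : ℕ} {v : ℕ → Fin N → ℝ} {p : Fin N → ℝ}
    (h : ∀ ε > 0, ∀ M, ∃ m, M ≤ m ∧ ∑ k, |v m k - p k| < ε) : IsAccPt1 N v p := by
  have hcl : MapClusterPt 0 atTop fun m => ∑ k, |v m k - p k| := by
    refine Metric.nhds_basis_ball.mapClusterPt_iff_frequently.2 fun ε hε => ?_
    refine frequently_atTop.2 fun M => ?_
    obtain ⟨m, hMm, hm⟩ := h ε hε M
    refine ⟨m, hMm, ?_⟩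
    rwa [Metric.mem_ball, Real.dist_eq, sub_zero,
      abs_of_nonneg (Finset.sum_nonneg fun k _ => abs_nonneg _)]
  exact hcl.tendsto_subseq

theorem isAccPt1_of_forall_mem_freqApproxSet {N : ℕ} {c : ℕ → ℕ → ℝ} {x : ℝ}
    (hx : ∀ a : Fin N → ℕ, (∀ i, 0 < a i) → ∀ h M, x ∈ freqApproxSet N c a h M)
    {p : Fin N → ℝ} (hp : p ∈ stdSimplex ℝ (Fin N)) : IsAccPt1 N (freqT N c x) p := by
  refine isAccPt1_of_forall_exists_lt fun ε hε M => ?_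
  obtain ⟨a, ha, hap⟩ := exists_pos_sum_abs_sub_lt hp (half_pos hε)
  obtain ⟨h, hh⟩ := exists_nat_one_div_lt (half_pos hε)
  obtain ⟨m, hMm, hm⟩ := interior_subset (hx a ha h M)
  refine ⟨m, hMm, ?_⟩
  calc ∑ k, |freqT N c x m k - p k|
      ≤ ∑ k, (|freqT N c x m k - a k / (∑ i, a i : ℕ)| + |(a k / (∑ i, a i : ℕ) : ℝ) - p k|) :=
        Finset.sum_le_sum fun k _ => abs_sub_le _ _ _
    _ < ε := by rw [Finset.sum_add_distrib]; linarith

theorem dense_preimage_val_Icc {u v : ℝ} (huv : u < v) {U : Set ℝ} (hU : Dense U) :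
    Dense (Subtype.val ⁻¹' U : Set (Set.Icc u v)) := by
  refine dense_iff_inter_open.2 fun V hV ⟨x, hxV⟩ => ?_
  obtain ⟨O, hO, rfl⟩ := isOpen_induced_iff.1 hV
  have hx : (x : ℝ) ∈ closure (Set.Ioo u v) := by
    rw [closure_Ioo huv.ne]
    exact x.2
  obtain ⟨y, hyO, hy⟩ := hU.inter_open_nonempty _ (hO.inter isOpen_Ioo)
    (mem_closure_iff.1 hx O hO hxV)
  exact ⟨⟨y, Set.Ioo_subset_Icc_self hyO.2⟩, hyO.1, hy⟩

/-- For every regular linear transformation `T = [c_{m,n}]`, the set of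
`x ∈ [0,1]` such that the set of ℓ¹-accumulation points of `(Π^T(x,m))_m` contains every
point of the simplex `Δ_N` is residual in `[0,1]`. -/
theorem residual_freqT_accumulates (N : ℕ) (hN : 2 ≤ N) (c : ℕ → ℕ → ℝ)
    (hc : IsRegularLT c) :
    {x : ↥(Set.Icc (0 : ℝ) 1) |
        ∀ p ∈ stdSimplex ℝ (Fin N), IsAccPt1 N (freqT N c ↑x) p} ∈
      residual ↥(Set.Icc (0 : ℝ) 1) := by
  have hmem : ∀ t : {a : Fin N → ℕ // ∀ i, 0 < a i} × ℕ × ℕ,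
      (Subtype.val ⁻¹' freqApproxSet N c t.1 t.2.1 t.2.2 : Set (Set.Icc (0 : ℝ) 1)) ∈
        residual (Set.Icc (0 : ℝ) 1) := fun t =>
    residual_of_dense_open (isOpen_interior.preimage continuous_subtype_val)
      (dense_preimage_val_Icc one_pos (dense_freqApproxSet hN hc t.1.2 _ _))
  filter_upwards [countable_iInter_mem.2 hmem] with x hx p hp
  exact isAccPt1_of_forall_mem_freqApproxSet
    (fun a ha h M => Set.mem_iInter.1 hx (⟨a, ha⟩, h, M)) hp
end

section
/- Fix an integer N ≥ 2. The set of x ∈ [0,1] such that the set of accumulation points (with respect to the ℓ¹ norm) of the digit-frequency sequence (Π(x,n))_n equals the full simplex Δ_N is residual (comeager) in [0,1]. -/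
open Filter Topology

/-- On the open cylinder `(M / N ^ n, (M + 1) / N ^ n)` the first `n` digits are those of `M`. -/
lemma digit_eq_of_mem_cylinder {N : ℕ} (hN : 2 ≤ N) {x : ℝ} {n M : ℕ}
    (h1 : (M : ℝ) < (N : ℝ) ^ n * x) (h2 : (N : ℝ) ^ n * x < M + 1) {j : ℕ}
    (hj : 1 ≤ j) (hjn : j ≤ n) : digit N x j = M / N ^ (n - j) % N := by
  have hN0 : 0 < N := by omega
  have hNR : (0 : ℝ) < N := by exact_mod_cast hN0
  have hceil : ∀ i, i ≤ n → ⌈(N : ℝ) ^ i * x⌉ = ((M / N ^ (n - i) : ℕ) : ℤ) + 1 := by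
    intro i hi
    have hp : (0 : ℝ) < (N : ℝ) ^ (n - i) := by positivity
    have hpow : (N : ℝ) ^ n = (N : ℝ) ^ (n - i) * (N : ℝ) ^ i := by
      rw [← pow_add]; congr 1; omega
    have hlo : ((M / N ^ (n - i) : ℕ) : ℝ) * (N : ℝ) ^ (n - i) ≤ M := by
      exact_mod_cast Nat.div_mul_le_self M (N ^ (n - i))
    have hhi : (M : ℝ) + 1 ≤ (((M / N ^ (n - i) : ℕ) : ℝ) + 1) * (N : ℝ) ^ (n - i) := by
      exact_mod_cast Nat.lt_mul_of_div_lt (Nat.lt_succ_self (M / N ^ (n - i))) (by positivity)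
    rw [hpow] at h1 h2
    rw [Int.ceil_eq_iff]
    rw [Int.cast_add, Int.cast_natCast, Int.cast_one]
    constructor
    · by_contra hc
      push Not at hc
      nlinarith
    · by_contra hc
      push Not at hc
      nlinarith
  unfold digit
  rw [hceil j hjn, hceil (j - 1) (by omega)]
  have e : n - (j - 1) = n - j + 1 := by omega
  rw [e, pow_succ, ← Nat.div_div_eq_div_mul]
  have := Nat.div_add_mod (M / N ^ (n - j)) N
  set a := M / N ^ (n - j)
  have h3 : (N : ℤ) * ((a / N : ℕ) : ℤ) + ((a % N : ℕ) : ℤ) = a := by exact_mod_cast this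
  have h4 : (a : ℤ) + 1 - N * (((a / N : ℕ) : ℤ) + 1) + N - 1 = ((a % N : ℕ) : ℤ) := by
    linarith
  rw [h4, Int.toNat_natCast]

lemma digit_lt {N : ℕ} (hN : 2 ≤ N) (x : ℝ) {j : ℕ} (hj : 1 ≤ j) : digit N x j < N := by
  have h : ⌈(N : ℝ) ^ j * x⌉ ≤ N * ⌈(N : ℝ) ^ (j - 1) * x⌉ := by
    rw [Int.ceil_le]
    push_cast
    obtain ⟨k, rfl⟩ := Nat.exists_eq_add_of_le' hj
    rw [pow_succ', mul_assoc, Nat.add_sub_cancel]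
    exact mul_le_mul_of_nonneg_left (Int.le_ceil _) (Nat.cast_nonneg _)
  unfold digit
  omega

lemma freqVec_mem_stdSimplex {N : ℕ} (hN : 2 ≤ N) (x : ℝ) {n : ℕ} (hn : 1 ≤ n) :
    freqVec N x n ∈ stdSimplex ℝ (Fin N) := by
  refine ⟨fun i => by unfold freqVec; positivity, ?_⟩
  unfold freqVec
  rw [← Finset.sum_div, div_eq_one_iff_eq (by positivity)]
  have h := Finset.card_eq_sum_card_fiberwise (s := Finset.Icc 1 n) (t := Finset.range N)
    (f := digit N x) (by
      intro j hj
      simpa using digit_lt hN x (Finset.mem_Icc.1 hj).1)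
  rw [Nat.card_Icc, Nat.add_sub_cancel, Finset.sum_range] at h
  exact_mod_cast h.symm

/-- Appending a prescribed word of digits to a natural number written in base `N`. -/
lemma exists_append_digits {N : ℕ} (A : ℕ) (d : ℕ → Fin N) (r : ℕ) :
    ∃ M : ℕ, A * N ^ r ≤ M ∧ M + 1 ≤ (A + 1) * N ^ r ∧
      ∀ j < r, M / N ^ (r - (j + 1)) % N = d j := by
  induction r with
  | zero => exact ⟨A, by simp, by simp, by simp⟩
  | succ r ih =>
    obtain ⟨M, h1, h2, h3⟩ := ih
    have hd := (d r).isLt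
    have hN : 0 < N := by omega
    refine ⟨M * N + d r, ?_, ?_, ?_⟩
    · rw [pow_succ, ← mul_assoc]
      exact (Nat.mul_le_mul_right N h1).trans (Nat.le_add_right _ _)
    · rw [pow_succ, ← mul_assoc]
      have := Nat.mul_le_mul_right N h2
      linarith
    · intro j hj
      rcases Nat.lt_succ_iff_lt_or_eq.1 hj with hj | rfl
      · have e : r + 1 - (j + 1) = (r - (j + 1)) + 1 := by omega
        have q : (M * N + d r) / N = M := by
          rw [Nat.add_div_of_dvd_right (Dvd.intro_left M rfl), Nat.mul_div_cancel _ hN,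
            Nat.div_eq_of_lt hd, add_zero]
        rw [e, pow_succ', ← Nat.div_div_eq_div_mul, q, h3 j hj]
      · simp [Nat.mod_eq_of_lt hd]

lemma exists_word_of_counts {N : ℕ} [NeZero N] (c : Fin N → ℕ) :
    ∃ d : ℕ → Fin N, ∀ i, ((Finset.range (∑ k, c k)).filter (fun j => d j = i)).card = c i := by
  let e : Fin (∑ k, c k) ≃ Σ k, Fin (c k) := finSigmaFinEquiv.symm
  refine ⟨fun j => if h : j < ∑ k, c k then (e ⟨j, h⟩).1 else 0, fun i => ?_⟩
  rw [← Fintype.card_fin (c i), ← Finset.card_univ]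
  symm
  refine Finset.card_bij (fun a _ => (e.symm ⟨i, a⟩ : ℕ)) ?_ ?_ ?_
  · intro a _
    simp
  · intro a _ b _ hab
    simpa using e.symm.injective (Fin.ext hab)
  · intro j hj
    simp only [Finset.mem_filter, Finset.mem_range] at hj
    obtain ⟨hj, he⟩ := hj
    rw [dif_pos hj] at he
    subst he
    exact ⟨(e ⟨j, hj⟩).2, Finset.mem_univ _, by simp⟩

/-- Words of any length `r` whose letter counts are within `N` of `r * p`. -/
lemma exists_word_near {N : ℕ} [NeZero N] {p : Fin N → ℝ} (hp : p ∈ stdSimplex ℝ (Fin N))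
    (r : ℕ) : ∃ d : ℕ → Fin N, ∀ i,
      |(((Finset.range r).filter (fun j => d j = i)).card : ℝ) - r * p i| ≤ N := by
  have hnn : ∀ i, 0 ≤ r * p i := fun i => mul_nonneg (Nat.cast_nonneg _) (hp.1 i)
  have hsum : ∑ i, r * p i = r := by rw [← Finset.mul_sum, hp.2, mul_one]
  set s := ∑ i, ⌊r * p i⌋₊ with hs
  have hsr : s ≤ r := by
    have : (s : ℝ) ≤ r := by
      calc (s : ℝ) = ∑ i, (⌊r * p i⌋₊ : ℝ) := by rw [hs]; push_cast; rfl
        _ ≤ ∑ i, r * p i := Finset.sum_le_sum fun i _ => Nat.floor_le (hnn i)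
        _ = r := hsum
    exact_mod_cast this
  have hrs : (r : ℝ) ≤ s + N := by
    calc (r : ℝ) = ∑ i, r * p i := hsum.symm
      _ ≤ ∑ i : Fin N, ((⌊r * p i⌋₊ : ℝ) + 1) :=
        Finset.sum_le_sum fun i _ => (Nat.lt_floor_add_one _).le
      _ = s + N := by rw [Finset.sum_add_distrib, hs]; simp
  have hN : (1 : ℝ) ≤ N := by exact_mod_cast NeZero.one_le
  let c : Fin N → ℕ := fun i => ⌊r * p i⌋₊ + Pi.single (M := fun _ => ℕ) 0 (r - s) i
  have hc : ∑ i, c i = r := by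
    simp only [c, Finset.sum_add_distrib, ← hs, Fintype.sum_pi_single']
    omega
  obtain ⟨d, hd⟩ := exists_word_of_counts c
  rw [hc] at hd
  refine ⟨d, fun i => ?_⟩
  rw [hd i]
  have h1 := Nat.floor_le (hnn i)
  have h2 := Nat.lt_floor_add_one (r * p i)
  have h3 : ((Pi.single (M := fun _ => ℕ) 0 (r - s) i : ℕ) : ℝ) ≤ N := by
    by_cases hi : i = 0
    · subst hi
      rw [Pi.single_eq_same, Nat.cast_sub hsr]
      linarith
    · simp [Pi.single_eq_of_ne hi]
  have h4 : (0 : ℝ) ≤ ((Pi.single (M := fun _ => ℕ) 0 (r - s) i : ℕ) : ℝ) := Nat.cast_nonneg _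
  simp only [c]
  push_cast
  rw [abs_le]
  constructor <;> linarith

lemma sum_abs_freqVec_sub_le {N : ℕ} {p : Fin N → ℝ} (hp : p ∈ stdSimplex ℝ (Fin N))
    {x : ℝ} {l r : ℕ} (hlr : 0 < l + r) {d : ℕ → Fin N}
    (hx : ∀ j < r, digit N x (l + (j + 1)) = d j)
    (hd : ∀ i, |(((Finset.range r).filter (fun j => d j = i)).card : ℝ) - r * p i| ≤ N) :
    ∑ i, |freqVec N x (l + r) i - p i| ≤ N * (l + N) / (l + r : ℕ) := by
  have hpos : (0 : ℝ) < (l + r : ℕ) := by exact_mod_cast hlr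
  have key : ∀ i, |freqVec N x (l + r) i - p i| ≤ (l + N) / (l + r : ℕ) := by
    intro i
    have hcount : ((Finset.Icc 1 (l + r)).filter (fun j => digit N x j = i.val)).card =
        ((Finset.range l).filter (fun j => digit N x (j + 1) = i.val)).card +
          ((Finset.range r).filter (fun j => d j = i)).card := by
      simp only [Finset.card_filter]
      rw [← Finset.Ico_add_one_right_eq_Icc,
        ← Finset.sum_Ico_add' (fun j => if digit N x j = i.val then 1 else 0) 0 (l + r) 1,
        ← Finset.range_eq_Ico, Finset.sum_range_add]
      congr 1
      refine Finset.sum_congr rfl fun j hj => ?_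
      rw [add_assoc, hx j (Finset.mem_range.1 hj)]
      simp only [Fin.ext_iff]
    have ha : (((Finset.range l).filter (fun j => digit N x (j + 1) = i.val)).card : ℝ) ≤ l := by
      exact_mod_cast (Finset.card_filter_le _ _).trans (Finset.card_range l).le
    have hpi : p i ≤ 1 := hp.2 ▸ Finset.single_le_sum (fun k _ => hp.1 k) (Finset.mem_univ i)
    have hp0 := hp.1 i
    have hb := abs_le.1 (hd i)
    have hl : (0 : ℝ) ≤ l := Nat.cast_nonneg l
    have ha0 : (0 : ℝ) ≤ ((Finset.range l).filter (fun j => digit N x (j + 1) = i.val)).card :=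
      Nat.cast_nonneg _
    unfold freqVec
    rw [hcount, div_sub' hpos.ne', abs_div, abs_of_pos hpos]
    gcongr
    push_cast
    rw [abs_le]
    constructor <;> nlinarith
  calc ∑ i, |freqVec N x (l + r) i - p i| ≤ ∑ _i : Fin N, ((l + N) / (l + r : ℕ) : ℝ) :=
        Finset.sum_le_sum fun i _ => key i
    _ = N * (l + N) / (l + r : ℕ) := by simp [mul_div_assoc]

/-- Digit frequencies come close to any given `p ∈ Δ_N` at arbitrarily late times, generically. -/
lemma residual_exists_freqVec_near {N : ℕ} (hN : 2 ≤ N) {p : Fin N → ℝ}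
    (hp : p ∈ stdSimplex ℝ (Fin N)) {ε : ℝ} (hε : 0 < ε) (m : ℕ) :
    {x : ↥(Set.Icc (0 : ℝ) 1) | ∃ n ≥ m, ∑ i, |freqVec N x n i - p i| < ε} ∈
      residual ↥(Set.Icc (0 : ℝ) 1) := by
  have : NeZero N := ⟨by omega⟩
  have hN1 : (1 : ℝ) < N := by exact_mod_cast (by omega : 1 < N)
  refine mem_of_superset (residual_of_dense_open isOpen_interior ?_) interior_subset
  rw [Metric.dense_iff]
  rintro ⟨x, hx0, hx1⟩ δ hδ
  obtain ⟨l, hl⟩ := exists_pow_lt_of_lt_one hδ (inv_lt_one_of_one_lt₀ hN1)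
  have hNl : (0 : ℝ) < (N : ℝ) ^ l := by positivity
  obtain ⟨A, hA, hAx, hxA⟩ : ∃ A : ℕ, A + 1 ≤ N ^ l ∧ (A : ℝ) ≤ (N : ℝ) ^ l * x ∧
      (N : ℝ) ^ l * x ≤ A + 1 := by
    rcases hx0.eq_or_lt with rfl | hx0
    · exact ⟨0, Nat.one_le_pow _ _ (by omega), by simp, by simp⟩
    · have hpos : 0 < ⌈(N : ℝ) ^ l * x⌉₊ := Nat.ceil_pos.2 (by positivity)
      obtain ⟨A, hA⟩ := Nat.exists_eq_add_of_lt hpos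
      rw [zero_add] at hA
      refine ⟨A, ?_, ?_, ?_⟩
      · rw [← hA, Nat.ceil_le]
        push_cast
        nlinarith
      · exact (Nat.lt_ceil.1 (by omega : A < ⌈(N : ℝ) ^ l * x⌉₊)).le
      · exact_mod_cast hA ▸ Nat.le_ceil ((N : ℝ) ^ l * x)
  obtain ⟨r, hr1, hr⟩ : ∃ r : ℕ, m + 1 ≤ r ∧ (N * (l + N) : ℝ) / (l + r : ℕ) < ε := by
    obtain ⟨r, hr⟩ := exists_nat_gt ((N * (l + N) : ℝ) / ε)
    refine ⟨r + (m + 1), by omega, ?_⟩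
    rw [div_lt_iff₀ hε] at hr
    rw [div_lt_iff₀ (by positivity)]
    push_cast
    nlinarith [(Nat.cast_nonneg l : (0 : ℝ) ≤ l), (Nat.cast_nonneg m : (0 : ℝ) ≤ m)]
  obtain ⟨d, hd⟩ := exists_word_near hp r
  obtain ⟨M, hM1, hM2, hM3⟩ := exists_append_digits A d r
  have hNr : (0 : ℝ) < (N : ℝ) ^ r := by positivity
  have hM1' : (A : ℝ) * (N : ℝ) ^ r ≤ M := by exact_mod_cast hM1
  have hM2' : (M : ℝ) + 1 ≤ (A + 1) * (N : ℝ) ^ r := by exact_mod_cast hM2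
  have hA' : (A : ℝ) + 1 ≤ (N : ℝ) ^ l := by exact_mod_cast hA
  obtain ⟨y, hy⟩ : ∃ y : ℝ, (N : ℝ) ^ (l + r) * y = M + 1 / 2 :=
    ⟨(M + 1 / 2) / (N : ℝ) ^ (l + r), by field_simp⟩
  have hyr : (N : ℝ) ^ l * y * (N : ℝ) ^ r = M + 1 / 2 := by rw [← hy, pow_add]; ring
  have hAy : (A : ℝ) ≤ (N : ℝ) ^ l * y := by
    refine le_of_mul_le_mul_right ?_ hNr
    linarith
  have hyA : (N : ℝ) ^ l * y ≤ A + 1 := by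
    refine le_of_mul_le_mul_right ?_ hNr
    linarith
  have hy0 : 0 ≤ y := by
    refine le_of_mul_le_mul_left ?_ hNl
    linarith [(Nat.cast_nonneg A : (0 : ℝ) ≤ A)]
  have hy1 : y ≤ 1 := by
    refine le_of_mul_le_mul_left ?_ hNl
    linarith
  refine ⟨⟨y, hy0, hy1⟩, ?_, ?_⟩
  · rw [Metric.mem_ball, Subtype.dist_eq, Real.dist_eq]
    refine lt_of_le_of_lt ?_ hl
    rw [inv_pow, ← one_div, abs_le, ← neg_div, div_le_iff₀ hNl, le_div_iff₀ hNl]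
    constructor <;> linarith
  · rw [mem_interior]
    refine ⟨{z | (M : ℝ) < (N : ℝ) ^ (l + r) * z ∧ (N : ℝ) ^ (l + r) * z < M + 1}, ?_, ?_, ?_⟩
    · rintro z ⟨hz1, hz2⟩
      refine ⟨l + r, by omega, lt_of_le_of_lt ?_ hr⟩
      refine sum_abs_freqVec_sub_le hp (by omega) (fun j hj => ?_) hd
      rw [digit_eq_of_mem_cylinder hN hz1 hz2 (by omega) (by omega), Nat.add_sub_add_left, hM3 j hj]
    · have hc : Continuous fun z : ↥(Set.Icc (0 : ℝ) 1) => (N : ℝ) ^ (l + r) * (z : ℝ) := by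
        fun_prop
      exact (isOpen_lt continuous_const hc).inter (isOpen_lt hc continuous_const)
    · constructor <;> simp only [hy] <;> linarith

lemma mem_stdSimplex_of_isAccPt1 {N : ℕ} (hN : 2 ≤ N) {x : ℝ} {p : Fin N → ℝ}
    (h : IsAccPt1 N (fun n => freqVec N x n) p) : p ∈ stdSimplex ℝ (Fin N) := by
  obtain ⟨φ, hφ, ht⟩ := h
  have hlim : Tendsto (fun u => freqVec N x (φ u)) atTop (𝓝 p) := by
    rw [tendsto_pi_nhds]
    intro i
    rw [tendsto_iff_dist_tendsto_zero]
    refine squeeze_zero (fun _ => dist_nonneg) (fun u => ?_) ht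
    exact Finset.single_le_sum (f := fun k => |freqVec N x (φ u) k - p k|)
      (fun _ _ => abs_nonneg _) (Finset.mem_univ i)
  refine (isClosed_stdSimplex ℝ (Fin N)).mem_of_tendsto hlim ?_
  filter_upwards [eventually_ge_atTop 1] with u hu
  exact freqVec_mem_stdSimplex hN x (hu.trans (hφ.id_le u))

lemma isAccPt1_of_forall_exists {N : ℕ} {v : ℕ → Fin N → ℝ} {p : Fin N → ℝ}
    (h : ∀ ε > 0, ∀ m, ∃ n ≥ m, ∑ i, |v n i - p i| < ε) : IsAccPt1 N v p := by
  obtain ⟨φ, hφ, hv⟩ := extraction_forall_of_frequently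
    (P := fun u n => ∑ i, |v n i - p i| < 1 / ((u : ℝ) + 1))
    fun u => frequently_atTop.2 fun m => h _ (by positivity) m
  exact ⟨φ, hφ, squeeze_zero (fun _ => Finset.sum_nonneg fun _ _ => abs_nonneg _)
    (fun u => (hv u).le) tendsto_one_div_add_atTop_nhds_zero_nat⟩

/-- The set of `x ∈ [0,1]` whose set of ℓ¹-accumulation points of the
digit-frequency sequence `(Π(x,n))_n` equals the full simplex `Δ_N` is residual in `[0,1]`. -/
theorem residual_freq_acc_eq_simplex (N : ℕ) (hN : 2 ≤ N) :
    {x : ↥(Set.Icc (0 : ℝ) 1) |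
        {p | IsAccPt1 N (fun n => freqVec N (↑x) n) p} = stdSimplex ℝ (Fin N)} ∈
      residual ↥(Set.Icc (0 : ℝ) 1) := by
  obtain ⟨D, hDc, hD⟩ := TopologicalSpace.exists_countable_dense ↥(stdSimplex ℝ (Fin N))
  have hres : ∀ᶠ x : ↥(Set.Icc (0 : ℝ) 1) in residual ↥(Set.Icc (0 : ℝ) 1),
      ∀ q ∈ D, ∀ k m : ℕ, ∃ n ≥ m, ∑ i, |freqVec N x n i - q.1 i| < 1 / ((k : ℝ) + 1) := by
    rw [eventually_countable_ball hDc]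
    intro q _
    rw [eventually_countable_forall]
    intro k
    rw [eventually_countable_forall]
    exact fun m => residual_exists_freqVec_near hN q.2 (by positivity) m
  filter_upwards [hres] with x hx
  refine Set.Subset.antisymm (fun p hp => mem_stdSimplex_of_isAccPt1 hN hp) fun p hp => ?_
  refine isAccPt1_of_forall_exists fun ε hε m => ?_
  obtain ⟨q, hq, hqD⟩ := hD.inter_open_nonempty
    {q : ↥(stdSimplex ℝ (Fin N)) | ∑ i, |q.1 i - p i| < ε / 2}
    (isOpen_lt (continuous_finsetSum _ fun i _ =>
      (((continuous_apply i).comp continuous_subtype_val).sub continuous_const).abs)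
      continuous_const) ⟨⟨p, hp⟩, by simpa using hε⟩
  obtain ⟨k, hk⟩ := exists_nat_one_div_lt (half_pos hε)
  obtain ⟨n, hn, hlt⟩ := hx q hqD k m
  refine ⟨n, hn, ?_⟩
  calc ∑ i, |freqVec N x n i - p i|
      ≤ ∑ i, (|freqVec N x n i - q.1 i| + |q.1 i - p i|) :=
        Finset.sum_le_sum fun i _ => abs_sub_le _ _ _
    _ = ∑ i, |freqVec N x n i - q.1 i| + ∑ i, |q.1 i - p i| := Finset.sum_add_distrib
    _ < ε := by
      have : ∑ i, |q.1 i - p i| < ε / 2 := hq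
      linarith
end

section
/- Fix an integer N ≥ 2. For every h ∈ ℕ and every increasing function ψ : ℕ → ℕ with ψ(n) > n² for all n, the set A_{h,ψ} := {x ∈ 𝕀 : the sequence (Π(x,n))_n has property P_{h,ψ}} is residual in 𝕀, where 𝕀 is the set of points of [0,1] whose base-N expansion is non-terminating. -/
open Filter Topology

/-- Greedily choosing the symbol with the largest deficit realises any probability vector as a
digit frequency, with bounded discrepancy. -/
theorem exists_seq_discrepancy_le {N : ℕ} (hN : 0 < N) (q : Fin N → ℝ)
    (hq : q ∈ stdSimplex ℝ (Fin N)) :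
    ∃ a : ℕ → Fin N, ∀ t : ℕ,
      ∑ i, |(((Finset.range t).filter (fun s => a s = i)).card : ℝ) - t * q i| ≤ 2 * N := by
  have : Nonempty (Fin N) := ⟨⟨0, hN⟩⟩
  have hmax : ∀ e : Fin N → ℝ, ∃ i, ∀ k, e k ≤ e i := fun e => Finite.exists_max e
  choose pick hpick using hmax
  let d : ℕ → Fin N → ℝ := fun t => Nat.rec (fun _ => 0)
    (fun _ d i => d i + q i - if pick (d + q) = i then 1 else 0) t
  have hd : ∀ t i, d (t + 1) i = d t i + q i - if pick (d t + q) = i then 1 else 0 :=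
    fun _ _ => rfl
  have hsum : ∀ t, ∑ i, d t i = 0 := by
    intro t
    induction t with
    | zero => simp [d]
    | succ t ih => simp [hd, Finset.sum_sub_distrib, Finset.sum_add_distrib, ih, hq.2]
  have hlow : ∀ t i, -1 < d t i := by
    intro t
    induction t with
    | zero => simp [d]
    | succ t ih =>
      intro i
      rw [hd]
      split_ifs with hi
      · have hpos : 0 < ∑ k, (d t + q) k := by
          simp [Finset.sum_add_distrib, hsum, hq.2]
        obtain ⟨k, -, hk⟩ := Finset.exists_lt_of_sum_lt
          (s := Finset.univ) (f := fun _ : Fin N => (0 : ℝ)) (g := d t + q) (by simpa using hpos)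
        have := hpick (d t + q) k
        rw [hi] at this
        simp only [Pi.add_apply] at this hk
        linarith
      · linarith [ih i, hq.1 i]
  have hcount : ∀ t i, (((Finset.range t).filter
      (fun s => pick (d s + q) = i)).card : ℝ) - t * q i = - d t i := by
    intro t i
    induction t with
    | zero => simp [d]
    | succ t ih =>
      rw [hd, Finset.range_add_one, Finset.filter_insert]
      split_ifs with hi
      · rw [Finset.card_insert_of_notMem (by simp)]
        push_cast
        linarith
      · push_cast
        linarith
  refine ⟨fun s => pick (d s + q), fun t => ?_⟩
  calc _ ≤ ∑ i, (d t i + 2) := by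
        refine Finset.sum_le_sum fun i _ => ?_
        rw [hcount, abs_le]
        constructor <;> linarith [hlow t i]
    _ = 2 * N := by simp [Finset.sum_add_distrib, hsum, mul_comm]

/-- The left endpoints, scaled by `N ^ (n₀ + t)`, of the nested `N`-adic intervals obtained from
the one with scaled endpoint `k` by appending the digits `a 0, a 1, …`. -/
def cylinderIndex (N : ℕ) (k : ℤ) (a : ℕ → Fin N) : ℕ → ℤ
  | 0 => k
  | t + 1 => N * cylinderIndex N k a t + (a t).val

/-- The open `N`-adic interval `(k / N ^ n, (k + 1) / N ^ n)`. -/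
def openCylinder (N n : ℕ) (k : ℤ) : Set ℝ :=
  {y | (k : ℝ) < (N : ℝ) ^ n * y ∧ (N : ℝ) ^ n * y < k + 1}

theorem isOpen_openCylinder (N n : ℕ) (k : ℤ) : IsOpen (openCylinder N n k) :=
  have hc : Continuous fun y : ℝ => (N : ℝ) ^ n * y := by fun_prop
  (isOpen_lt continuous_const hc).inter (isOpen_lt hc continuous_const)

theorem ceil_of_mem_openCylinder {N n : ℕ} {k : ℤ} {y : ℝ} (hy : y ∈ openCylinder N n k) :
    ⌈(N : ℝ) ^ n * y⌉ = k + 1 := by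
  rw [Int.ceil_eq_iff]
  push_cast
  exact ⟨by linarith [hy.1], hy.2.le⟩

theorem exists_irrational_mem_openCylinder {N : ℕ} (hN : 0 < N) (n : ℕ) (k : ℤ) :
    ∃ y ∈ openCylinder N n k, Irrational y := by
  have hpos : (0 : ℝ) < (N : ℝ) ^ n := by positivity
  obtain ⟨y, hy, h1, h2⟩ := exists_irrational_btwn
    (show (k : ℝ) / (N : ℝ) ^ n < (k + 1) / (N : ℝ) ^ n by gcongr; linarith)
  rw [div_lt_iff₀ hpos] at h1
  rw [lt_div_iff₀ hpos] at h2
  exact ⟨y, ⟨by linarith, by linarith⟩, hy⟩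

theorem antitone_openCylinder_cylinderIndex (N n₀ : ℕ) (k : ℤ) (a : ℕ → Fin N) :
    Antitone fun t => openCylinder N (n₀ + t) (cylinderIndex N k a t) := by
  refine antitone_nat_of_succ_le fun t y hy => ?_
  obtain ⟨h1, h2⟩ := hy
  have ha : ((a t).val : ℝ) + 1 ≤ N := by exact_mod_cast (a t).isLt
  have ha0 : (0 : ℝ) ≤ ((a t).val : ℝ) := by positivity
  have hN : (0 : ℝ) < N := by linarith
  rw [← add_assoc, pow_succ', mul_assoc] at h1 h2
  simp only [cylinderIndex] at h1 h2
  push_cast at h1 h2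
  constructor <;> refine lt_of_mul_lt_mul_left ?_ hN.le <;> linarith

theorem digit_of_mem_openCylinder {N n₀ T : ℕ} {k : ℤ} {a : ℕ → Fin N} {y : ℝ}
    (hy : y ∈ openCylinder N (n₀ + T) (cylinderIndex N k a T)) {s : ℕ} (hs : s < T) :
    digit N y (n₀ + s + 1) = (a s).val := by
  have h0 := ceil_of_mem_openCylinder (antitone_openCylinder_cylinderIndex N n₀ k a hs.le hy)
  have h1 := ceil_of_mem_openCylinder
    (antitone_openCylinder_cylinderIndex N n₀ k a (Nat.succ_le_of_lt hs) hy)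
  rw [Nat.succ_eq_add_one, ← add_assoc, cylinderIndex] at h1
  rw [digit, Nat.add_sub_cancel, h0, h1]
  have : (N : ℤ) * cylinderIndex N k a s + ((a s).val : ℤ) + 1
      - (N : ℤ) * (cylinderIndex N k a s + 1) + (N : ℤ) - 1 = ((a s).val : ℤ) := by ring
  rw [this, Int.toNat_natCast]

theorem card_filter_digit_of_mem_openCylinder {N n₀ T : ℕ} {k : ℤ} {a : ℕ → Fin N} {y : ℝ}
    (hy : y ∈ openCylinder N (n₀ + T) (cylinderIndex N k a T)) (i : Fin N) {t : ℕ} (ht : t ≤ T) :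
    ((Finset.Icc 1 (n₀ + t)).filter (fun j => digit N y j = i.val)).card =
      ((Finset.Icc 1 n₀).filter (fun j => digit N y j = i.val)).card +
        ((Finset.range t).filter (fun s => a s = i)).card := by
  induction t with
  | zero => simp
  | succ t ih =>
    rw [← add_assoc, ← Finset.insert_Icc_right_eq_Icc_add_one (by lia), Finset.filter_insert,
      Finset.range_add_one, Finset.filter_insert, digit_of_mem_openCylinder hy ht]
    simp only [Fin.val_inj]
    split_ifs with hi
    · rw [Finset.card_insert_of_notMem (by simp), Finset.card_insert_of_notMem (by simp),
        ih (by lia), add_assoc]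
    · exact ih (by lia)

theorem sum_abs_freqVec_sub_le_s4 {N n₀ T : ℕ} {k : ℤ} {a : ℕ → Fin N} {y : ℝ} {q : Fin N → ℝ}
    (hq : q ∈ stdSimplex ℝ (Fin N))
    (ha : ∀ t : ℕ,
      ∑ i, |(((Finset.range t).filter (fun s => a s = i)).card : ℝ) - t * q i| ≤ 2 * N)
    (hy : y ∈ openCylinder N (n₀ + T) (cylinderIndex N k a T))
    {n : ℕ} (hn0 : 0 < n) (hn : n₀ ≤ n) (hnT : n ≤ n₀ + T) :
    n * ∑ i, |freqVec N y n i - q i| ≤ N * (n₀ + 2) := by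
  obtain ⟨t, rfl⟩ := Nat.exists_eq_add_of_le hn
  have hpos : (0 : ℝ) < ((n₀ + t : ℕ) : ℝ) := by exact_mod_cast hn0
  have hbound : ∀ i, ((n₀ + t : ℕ) : ℝ) * |freqVec N y (n₀ + t) i - q i| ≤
      n₀ + |(((Finset.range t).filter (fun s => a s = i)).card : ℝ) - t * q i| := by
    intro i
    have hc := card_filter_digit_of_mem_openCylinder hy i (t := t) (by lia)
    set c := ((Finset.Icc 1 n₀).filter (fun j => digit N y j = i.val)).card
    have hc0 : (c : ℝ) ≤ n₀ := by
      have := Finset.card_filter_le (Finset.Icc 1 n₀) (fun j => digit N y j = i.val)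
      rw [Nat.card_Icc, Nat.add_sub_cancel] at this
      exact_mod_cast this
    have hqi0 := hq.1 i
    have hqi1 : q i ≤ 1 := hq.2 ▸ Finset.single_le_sum (fun k _ => hq.1 k) (Finset.mem_univ i)
    rw [← abs_of_pos hpos, ← abs_mul, mul_sub, freqVec,
      mul_div_cancel₀ _ hpos.ne', hc]
    have hsplit : ((c + ((Finset.range t).filter (fun s => a s = i)).card : ℕ) : ℝ)
        - ((n₀ + t : ℕ) : ℝ) * q i = (c - n₀ * q i) +
          ((((Finset.range t).filter (fun s => a s = i)).card : ℝ) - t * q i) := by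
      push_cast; ring
    rw [hsplit]
    refine (abs_add_le _ _).trans (add_le_add_left ?_ _)
    rw [abs_le]
    have hn₀ : (0 : ℝ) ≤ n₀ := by positivity
    have hc' : (0 : ℝ) ≤ c := by positivity
    constructor <;> nlinarith
  rw [Finset.mul_sum]
  calc _ ≤ ∑ i, ((n₀ : ℝ) +
        |(((Finset.range t).filter (fun s => a s = i)).card : ℝ) - t * q i|) :=
        Finset.sum_le_sum fun i _ => hbound i
    _ ≤ N * (n₀ + 2) := by
        rw [Finset.sum_add_distrib]
        simp only [Finset.sum_const, Finset.card_univ, Fintype.card_fin, nsmul_eq_mul]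
        linarith [ha t]

theorem mem_Iset_of_irrational {N : ℕ} {y : ℝ} (hy : Irrational y) (h01 : y ∈ Set.Icc (0 : ℝ) 1) :
    y ∈ Iset N := by
  refine ⟨h01, ?_⟩
  rintro ⟨n, k, -, rfl⟩
  exact hy ⟨(k : ℚ) / (N : ℚ) ^ n, by push_cast; rfl⟩

theorem pos_of_mem_Iset {N : ℕ} {x : ℝ} (hx : x ∈ Iset N) : 0 < x := by
  refine hx.1.1.lt_of_ne fun h0 => hx.2 ⟨0, 0, by simp, ?_⟩
  simp [← h0]

theorem countable_Dset (N : ℕ) : (Dset N).Countable := by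
  refine (Set.countable_range (fun r : Fin N → ℚ => fun i => (r i : ℝ))).mono ?_
  rintro q ⟨-, hr, -⟩
  choose r hr using hr
  exact ⟨r, funext fun i => (hr i).symm⟩

/-- Inside every `N`-adic interval there is a smaller one on whose points the digit frequencies
stay close to `q` over the whole window `[j, ψ^[m] j]`, for some large `j`. -/
theorem exists_openCylinder_window {N : ℕ} (hN : 0 < N) {h : ℕ} (hh : 0 < h) {ψ : ℕ → ℕ}
    (hsq : ∀ n, n ^ 2 < ψ n) (i m n₀ : ℕ) (k : ℤ) {q : Fin N → ℝ}
    (hq : q ∈ stdSimplex ℝ (Fin N)) :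
    ∃ n k', openCylinder N n k' ⊆ openCylinder N n₀ k ∧ ∃ j : ℕ, i ≤ j ∧
      (j : ℝ) / (ψ j : ℝ) ≤ 1 / (h : ℝ) ∧ ∀ y ∈ openCylinder N n k',
        ∀ n : ℕ, j ≤ n → n ≤ ψ^[m] j → ∑ k, |freqVec N y n k - q k| < 1 / (h : ℝ) := by
  obtain ⟨a, ha⟩ := exists_seq_discrepancy_le hN q hq
  let j := i + n₀ + h * (N * (n₀ + 2)) + h
  have hh' : (0 : ℝ) < h := by exact_mod_cast hh
  refine ⟨n₀ + ψ^[m] j, cylinderIndex N k a (ψ^[m] j),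
    antitone_openCylinder_cylinderIndex N n₀ k a (Nat.zero_le _), j, by lia, ?_, ?_⟩
  · have hψ : (0 : ℝ) < ψ j := by exact_mod_cast (Nat.zero_le _).trans_lt (hsq j)
    rw [div_le_div_iff₀ hψ hh', one_mul]
    have hjh : h ≤ j := by lia
    have : j * h ≤ ψ j := by nlinarith [hsq j]
    exact_mod_cast this
  · intro y hy n hjn hn
    have hjpos : 0 < j := by lia
    have hle := sum_abs_freqVec_sub_le_s4 hq ha hy (n := n) (by lia) (by lia) (by lia)
    have hn0 : (0 : ℝ) < n := by exact_mod_cast hjpos.trans_le hjn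
    have hlt : h * (N * (n₀ + 2)) < n := by lia
    have hlt' : (h : ℝ) * (N * (n₀ + 2)) < n := by exact_mod_cast hlt
    rw [lt_div_iff₀ hh']
    refine lt_of_mul_lt_mul_left ?_ hn0.le
    nlinarith

theorem exists_openCylinder_near {N : ℕ} (hN : 2 ≤ N) {x : ℝ} (hx : x ∈ Iset N) {ε : ℝ}
    (hε : 0 < ε) : ∃ n k, ∀ y ∈ openCylinder N n k, y ∈ Set.Icc (0 : ℝ) 1 ∧ |y - x| < ε := by
  have hN1 : (1 : ℝ) < N := by exact_mod_cast hN
  obtain ⟨n, hn⟩ := pow_unbounded_of_one_lt (1 / ε) hN1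
  have hpos : (0 : ℝ) < (N : ℝ) ^ n := by positivity
  rw [div_lt_iff₀ hε] at hn
  refine ⟨n, ⌈(N : ℝ) ^ n * x⌉ - 1, ?_⟩
  rintro y ⟨h1, h2⟩
  push_cast at h1 h2
  rw [sub_add_cancel] at h2
  have hlo : (1 : ℝ) ≤ ⌈(N : ℝ) ^ n * x⌉ := by
    exact_mod_cast Int.one_le_ceil_iff.2 (mul_pos hpos (pos_of_mem_Iset hx))
  have hup : (⌈(N : ℝ) ^ n * x⌉ : ℝ) ≤ (N : ℝ) ^ n := by
    have : ⌈(N : ℝ) ^ n * x⌉ ≤ (N : ℤ) ^ n := by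
      rw [Int.ceil_le]
      push_cast
      exact mul_le_of_le_one_right hpos.le hx.1.2
    exact_mod_cast this
  have hc1 := Int.le_ceil ((N : ℝ) ^ n * x)
  have hc2 := Int.ceil_lt_add_one ((N : ℝ) ^ n * x)
  refine ⟨⟨?_, ?_⟩, ?_⟩
  · refine le_of_mul_le_mul_left ?_ hpos
    linarith
  · refine le_of_mul_le_mul_left ?_ hpos
    linarith
  · rw [abs_lt]
    constructor <;> refine lt_of_mul_lt_mul_left ?_ hpos.le <;> linarith

/-- For every `h ≥ 1` and every increasing `ψ : ℕ → ℕ` with `ψ(n) > n²`,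
the set `A_{h,ψ}` of `x ∈ 𝕀` such that `(Π(x,n))_n` has property `P_{h,ψ}` is
residual in `𝕀`. -/
theorem residual_A_h_psi (N : ℕ) (hN : 2 ≤ N) (h : ℕ) (hh : 0 < h)
    (ψ : ℕ → ℕ) (hmono : StrictMono ψ) (hsq : ∀ n, n ^ 2 < ψ n) :
    {x : ↥(Iset N) | PropP N h ψ (fun n => freqVec N (↑x) n)} ∈
      residual ↥(Iset N) := by
  have hset : {x : ↥(Iset N) | PropP N h ψ (fun n => freqVec N (↑x) n)} =
      ⋂ (i : ℕ) (m : ℕ), ⋂ q ∈ Dset N, {x : ↥(Iset N) | ∃ j : ℕ, i ≤ j ∧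
        (j : ℝ) / (ψ j : ℝ) ≤ 1 / (h : ℝ) ∧
        ∀ n : ℕ, j ≤ n → n ≤ ψ^[m] j → ∑ k, |freqVec N x n k - q k| < 1 / (h : ℝ)} := by
    ext x
    simp [PropP]
  rw [hset]
  refine countable_iInter_mem.2 fun i => countable_iInter_mem.2 fun m =>
    (countable_bInter_mem (countable_Dset N)).2 fun q hq => ?_
  refine mem_of_superset (residual_of_dense_open isOpen_interior ?_) interior_subset
  rw [Metric.dense_iff]
  intro x ε hε
  have hN0 : 0 < N := by lia
  obtain ⟨n₀, k₀, hnear⟩ := exists_openCylinder_near hN x.2 hε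
  obtain ⟨n, k, hsub, j, hij, hjψ, hwin⟩ :=
    exists_openCylinder_window hN0 hh hsq i m n₀ k₀ hq.1
  obtain ⟨y, hy, hirr⟩ := exists_irrational_mem_openCylinder hN0 n k
  obtain ⟨h01, hyx⟩ := hnear y (hsub hy)
  refine ⟨⟨y, mem_Iset_of_irrational hirr h01⟩, hyx, mem_interior.2
    ⟨Subtype.val ⁻¹' openCylinder N n k, fun z hz => ⟨j, hij, hjψ, hwin z hz⟩,
      (isOpen_openCylinder N n k).preimage continuous_subtype_val, hy⟩⟩
end

section
/- Fix an integer N ≥ 2, h ∈ ℕ, an increasing function ψ : ℕ → ℕ with ψ(n) > n² for all n, natural numbers i, m, and a vector q ∈ 𝔻. Then the set G_{h,ψ,i,m,q} := {x ∈ 𝕀 : there exists j ∈ ℕ with j ≥ i, j/ψ(j) < 1/h, and ‖Π(x,n) − q‖₁ < 1/h for all n with j < n < ψ^m(j)} is a dense subset of 𝕀. -/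
open Filter Topology

/-- A digit sequence extending a given prefix of length `L` whose digit counts stay within bounded
distance of the prescribed frequencies `q`. -/
lemma exists_digits_count_near {N : ℕ} {q : Fin N → ℝ} (hq : q ∈ stdSimplex ℝ (Fin N))
    (b : ℕ → Fin N) (L : ℕ) :
    ∃ a : ℕ → Fin N, (∀ j < L, a j = b j) ∧
      ∃ C : ℝ, ∀ n k, |(Nat.count (fun j => a j = k) n : ℝ) - n * q k| ≤ C := by
  have hchoice : ∀ v : Fin N → ℝ, ∃ k, ∑ k, v k = 0 → 0 < v k + q k := by
    intro v
    by_cases hv : ∑ k, v k = 0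
    · have hsum : ∑ k : Fin N, (0 : ℝ) < ∑ k, (v k + q k) := by
        rw [Finset.sum_add_distrib, hv, hq.2]
        simp
      obtain ⟨k, -, hk⟩ := Finset.exists_lt_of_sum_lt hsum
      exact ⟨k, fun _ => hk⟩
    · exact ⟨b 0, fun h => absurd h hv⟩
  choose f hf using hchoice
  let g : ℕ → (Fin N → ℝ) → Fin N := fun n v => if n < L then b n else f v
  let s : ℕ → Fin N → ℝ := fun n => Nat.rec (fun _ => 0)
    (fun n v k => v k + q k - if g n v = k then 1 else 0) n
  have hs : ∀ n k, s (n + 1) k = s n k + q k - if g n (s n) = k then 1 else 0 :=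
    fun _ _ => rfl
  have hsum : ∀ n, ∑ k, s n k = 0 := by
    intro n
    induction n with
    | zero => simp [s]
    | succ n ih =>
      simp only [hs, Finset.sum_sub_distrib, Finset.sum_add_distrib, ih, hq.2]
      simp
  have hlow : ∀ n k, -(L : ℝ) - 1 ≤ s n k ∧ (n ≤ L → -(n : ℝ) ≤ s n k) := by
    intro n
    induction n with
    | zero =>
      intro k
      have h0 : s 0 k = 0 := rfl
      have := (Nat.cast_nonneg L : (0 : ℝ) ≤ L)
      rw [h0]
      exact ⟨by linarith, by simp⟩
    | succ n ih =>
      intro k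
      have hqk := hq.1 k
      obtain ⟨h1, h2⟩ := ih k
      rw [hs]
      by_cases hn : n < L
      · have h3 := h2 hn.le
        have h4 : (n : ℝ) + 1 ≤ L := by exact_mod_cast hn
        push_cast
        split_ifs
        · exact ⟨by linarith, fun _ => by linarith⟩
        · exact ⟨by linarith, fun _ => by linarith⟩
      · refine ⟨?_, fun h => absurd h hn⟩
        have := (Nat.cast_nonneg L : (0 : ℝ) ≤ L)
        split_ifs with hk
        · have hg : g n (s n) = f (s n) := if_neg hn
          have := hf (s n) (hsum n)
          rw [← hg, hk] at this
          linarith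
        · linarith
  refine ⟨fun n => g n (s n), fun j hj => if_pos hj, N * (L + 1), fun n k => ?_⟩
  have hcount : (Nat.count (fun j => g j (s j) = k) n : ℝ) - n * q k = -s n k := by
    induction n with
    | zero => simp [s]
    | succ n ih =>
      rw [Nat.count_succ, hs]
      push_cast
      linarith
  rw [hcount, abs_neg, abs_le]
  have hN : (1 : ℝ) ≤ N := by exact_mod_cast Fin.pos k
  have hL := (Nat.cast_nonneg L : (0 : ℝ) ≤ L)
  constructor
  · nlinarith [(hlow n k).1]
  · have h1 : s n k + (L + 1) ≤ ∑ k, (s n k + (L + 1)) :=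
      Finset.single_le_sum (f := fun k => s n k + ((L : ℝ) + 1))
        (fun k _ => by linarith [(hlow n k).1]) (Finset.mem_univ k)
    rw [Finset.sum_add_distrib, hsum] at h1
    simp at h1
    linarith

lemma exists_ge_of_count_near {p : ℕ → Prop} [DecidablePred p] {r C : ℝ} (hr : 0 < r)
    (hC : ∀ n : ℕ, |(Nat.count p n : ℝ) - n * r| ≤ C) (n : ℕ) : ∃ i ≥ n, p i := by
  by_contra! hcon
  have hconst : ∀ m, Nat.count p (n + m) = Nat.count p n := by
    intro m
    induction m with
    | zero => rfl
    | succ m ih => rw [← add_assoc, Nat.count_succ, ih, if_neg (hcon _ (by omega)), add_zero]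
  obtain ⟨m, hm⟩ := exists_nat_gt ((n + C) / r)
  rw [div_lt_iff₀ hr] at hm
  have h1 := (abs_le.1 (hC (n + m))).1
  rw [hconst] at h1
  push_cast at h1
  have h2 : (Nat.count p n : ℝ) ≤ n := by exact_mod_cast Nat.count_le p
  nlinarith [mul_nonneg (Nat.cast_nonneg (α := ℝ) n) hr.le]

lemma exists_pos_of_ne_vertex {N : ℕ} {q : Fin N → ℝ} (hq : q ∈ stdSimplex ℝ (Fin N))
    {c : ℕ} (hc : c < N) (hne : q ≠ fun i => if i.val = c then 1 else 0) :
    ∃ k, k.val ≠ c ∧ 0 < q k := by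
  by_contra! hcon
  have hzero : ∀ k : Fin N, k.val ≠ c → q k = 0 := fun k hk => le_antisymm (hcon k hk) (hq.1 k)
  have hone : q ⟨c, hc⟩ = 1 := by
    rw [← hq.2, Finset.sum_eq_single ⟨c, hc⟩]
    · exact fun k _ hk => hzero k fun h => hk (Fin.ext h)
    · simp
  refine hne (funext fun k => ?_)
  split_ifs with hk
  · rw [← hone]
    exact congrArg q (Fin.ext hk)
  · exact hzero k hk

lemma ofDigits_pos_s6 {N : ℕ} {a : ℕ → Fin N} {i : ℕ} (hi : (a i).val ≠ 0) :
    0 < Real.ofDigits a := by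
  have hN : 0 < N := Fin.pos (a i)
  have hpos : 0 < Real.ofDigitsTerm a i := by
    unfold Real.ofDigitsTerm
    have : 0 < (a i).val := Nat.pos_of_ne_zero hi
    positivity
  exact hpos.trans_le
    (Real.summable_ofDigitsTerm.le_tsum i fun _ _ => Real.ofDigitsTerm_nonneg)

lemma ofDigits_add_ofDigits_rev {N : ℕ} (hN : 1 < N) (a : ℕ → Fin N) :
    Real.ofDigits a + Real.ofDigits (fun i => (a i).rev) = 1 := by
  rw [← Real.ofDigits_const_last_eq_one' hN]
  unfold Real.ofDigits
  rw [← Real.summable_ofDigitsTerm.tsum_add Real.summable_ofDigitsTerm]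
  refine tsum_congr fun i => ?_
  unfold Real.ofDigitsTerm
  rw [← add_mul]
  congr 1
  have := (a i).isLt
  have h : (a i).val + (a i).rev.val = N - 1 := by
    rw [Fin.val_rev]
    omega
  exact_mod_cast h

lemma ofDigits_lt_one {N : ℕ} (hN : 1 < N) {a : ℕ → Fin N} {i : ℕ} (hi : (a i).val ≠ N - 1) :
    Real.ofDigits a < 1 := by
  have hrev : ((a i).rev).val ≠ 0 := by
    have := (a i).isLt
    rw [Fin.val_rev]
    omega
  have := ofDigits_pos_s6 (a := fun i => (a i).rev) hrev
  linarith [ofDigits_add_ofDigits_rev hN a]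

/-- The integer with base-`N` digits `a 0, …, a (n - 1)`, most significant first. -/
def prefixNat {N : ℕ} (a : ℕ → Fin N) : ℕ → ℕ
  | 0 => 0
  | n + 1 => N * prefixNat a n + (a n).val

lemma pow_mul_ofDigits {N : ℕ} (hN : 0 < N) (a : ℕ → Fin N) (n : ℕ) :
    (N : ℝ) ^ n * Real.ofDigits a = prefixNat a n + Real.ofDigits (fun i => a (i + n)) := by
  have hN' : (N : ℝ) ≠ 0 := by positivity
  have hprefix : (N : ℝ) ^ n * ∑ i ∈ Finset.range n, Real.ofDigitsTerm a i = prefixNat a n := by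
    induction n with
    | zero => simp [prefixNat]
    | succ n ih =>
      rw [Finset.sum_range_succ, mul_add, pow_succ', mul_assoc, ih, Real.ofDigitsTerm, prefixNat]
      push_cast
      field_simp
      ring
  rw [Real.ofDigits_eq_sum_add_ofDigits a n, mul_add, hprefix, mul_inv_cancel_left₀ (by positivity)]

lemma ceil_pow_mul_ofDigits {N : ℕ} {a : ℕ → Fin N}
    (ha : ∀ n, ∃ i ≥ n, (a i).val ≠ 0) (n : ℕ) :
    ⌈(N : ℝ) ^ n * Real.ofDigits a⌉ = prefixNat a n + 1 := by
  rw [pow_mul_ofDigits (Fin.pos (a 0)), Int.ceil_eq_iff]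
  obtain ⟨i, hi, hai⟩ := ha n
  have hpos : 0 < Real.ofDigits (fun i => a (i + n)) :=
    ofDigits_pos_s6 (i := i - n) (by rwa [Nat.sub_add_cancel hi])
  have hle := Real.ofDigits_le_one (fun i => a (i + n))
  push_cast
  constructor <;> linarith

lemma digit_ofDigits {N : ℕ} {a : ℕ → Fin N}
    (ha : ∀ n, ∃ i ≥ n, (a i).val ≠ 0) (j : ℕ) :
    digit N (Real.ofDigits a) (j + 1) = a j := by
  rw [digit, Nat.add_sub_cancel, ceil_pow_mul_ofDigits ha, ceil_pow_mul_ofDigits ha, prefixNat]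
  push_cast
  have : (N : ℤ) * prefixNat a j + (a j).val + 1 - N * (prefixNat a j + 1) + N - 1
      = ((a j).val : ℤ) := by ring
  rw [this, Int.toNat_natCast]

lemma ofDigits_mem_Iset {N : ℕ} (hN : 1 < N) {a : ℕ → Fin N}
    (ha : ∀ n, ∃ i ≥ n, (a i).val ≠ 0) (ha' : ∀ n, ∃ i ≥ n, (a i).val ≠ N - 1) :
    Real.ofDigits a ∈ Iset N := by
  refine ⟨⟨Real.ofDigits_nonneg a, Real.ofDigits_le_one a⟩, ?_⟩
  rintro ⟨n, k, -, hk⟩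
  have hN0 : (N : ℝ) ≠ 0 := by positivity
  rw [eq_div_iff (by positivity), mul_comm, pow_mul_ofDigits (by omega)] at hk
  obtain ⟨i, hi, hai⟩ := ha n
  obtain ⟨i', hi', hai'⟩ := ha' n
  have hpos : 0 < Real.ofDigits (fun i => a (i + n)) :=
    ofDigits_pos_s6 (i := i - n) (by rwa [Nat.sub_add_cancel hi])
  have hlt : Real.ofDigits (fun i => a (i + n)) < 1 :=
    ofDigits_lt_one hN (i := i' - n) (by rwa [Nat.sub_add_cancel hi'])
  have h1 : (prefixNat a n : ℝ) < k := by linarith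
  have h2 : (k : ℝ) < prefixNat a n + 1 := by linarith
  norm_cast at h1 h2
  omega

lemma freqVec_ofDigits {N : ℕ} {a : ℕ → Fin N}
    (ha : ∀ n, ∃ i ≥ n, (a i).val ≠ 0) (n : ℕ) (k : Fin N) :
    freqVec N (Real.ofDigits a) n k = (Nat.count (fun j => a j = k) n : ℝ) / n := by
  rw [freqVec, Nat.count_eq_card_filter_range]
  congr 2
  symm
  refine Finset.card_bij (fun j _ => j + 1) ?_ (by simp) ?_
  · intro j hj
    simp only [Finset.mem_filter, Finset.mem_range, Finset.mem_Icc] at hj ⊢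
    exact ⟨by omega, by rw [digit_ofDigits ha, hj.2]⟩
  · intro j hj
    simp only [Finset.mem_filter, Finset.mem_Icc] at hj
    obtain ⟨l, rfl⟩ := Nat.exists_eq_add_of_le' hj.1.1
    rw [digit_ofDigits ha] at hj
    exact ⟨l, by simpa using ⟨by omega, Fin.ext hj.2⟩, rfl⟩

/-- The set `G_{h,ψ,i,m,q}` is dense in `𝕀`. -/
theorem dense_G (N : ℕ) (hN : 2 ≤ N) (h : ℕ) (hh : 0 < h)
    (ψ : ℕ → ℕ) (hmono : StrictMono ψ) (hsq : ∀ n, n ^ 2 < ψ n)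
    (i m : ℕ) (q : Fin N → ℝ) (hq : q ∈ Dset N) :
    Dense {x : ↥(Iset N) | ∃ j : ℕ, i ≤ j ∧ (j : ℝ) / (ψ j : ℝ) < 1 / (h : ℝ) ∧
      ∀ n : ℕ, j < n → n < ψ^[m] j →
        ∑ k, |freqVec N (↑x) n k - q k| < 1 / (h : ℝ)} := by
  have hN0 : 0 < N := by omega
  rw [Metric.dense_iff]
  intro x ε hε
  obtain ⟨b, -, hb⟩ := Real.ofDigits_SurjOn (b := N) (by omega) x.2.1
  have hNinv : (N : ℝ)⁻¹ < 1 := inv_lt_one_of_one_lt₀ (by exact_mod_cast hN)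
  obtain ⟨L, hL⟩ := exists_pow_lt_of_lt_one hε hNinv
  obtain ⟨a, hab, C, hC⟩ := exists_digits_count_near hq.1 b L
  obtain ⟨k₀, hk₀, hqk₀⟩ := exists_pos_of_ne_vertex hq.1 hN0 hq.2.2.1
  obtain ⟨k₁, hk₁, hqk₁⟩ := exists_pos_of_ne_vertex hq.1 (by omega : N - 1 < N) hq.2.2.2
  have ha : ∀ n, ∃ i ≥ n, (a i).val ≠ 0 := fun n => by
    obtain ⟨l, hl, rfl⟩ := exists_ge_of_count_near hqk₀ (fun n => hC n k₀) n
    exact ⟨l, hl, hk₀⟩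
  have ha' : ∀ n, ∃ i ≥ n, (a i).val ≠ N - 1 := fun n => by
    obtain ⟨l, hl, rfl⟩ := exists_ge_of_count_near hqk₁ (fun n => hC n k₁) n
    exact ⟨l, hl, hk₁⟩
  refine ⟨⟨Real.ofDigits a, ofDigits_mem_Iset (by omega) ha ha'⟩, ?_, ?_⟩
  · rw [Metric.mem_ball, Subtype.dist_eq, Real.dist_eq, ← hb]
    refine (Real.abs_ofDigits_sub_ofDigits_le hab).trans_lt ?_
    rwa [← inv_pow]
  · obtain ⟨j₀, hj₀⟩ := exists_nat_ge (N * C * h)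
    have hh' : (0 : ℝ) < h := by exact_mod_cast hh
    refine ⟨max i (max h j₀), le_max_left _ _, ?_, ?_⟩
    · set j := max i (max h j₀)
      have hhj : h ≤ j := (le_max_left h j₀).trans (le_max_right _ _)
      have hψ : (j : ℝ) ^ 2 < ψ j := by exact_mod_cast hsq j
      have hhj' : (h : ℝ) ≤ j := by exact_mod_cast hhj
      rw [div_lt_div_iff₀ (by nlinarith) hh']
      nlinarith
    · intro n hn _
      have hjn : j₀ < n :=
        ((le_max_right h j₀).trans (le_max_right i _)).trans_lt hn
      have hn0 : (0 : ℝ) < n := by exact_mod_cast (Nat.zero_le j₀).trans_lt hjn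
      have hjn' : (j₀ : ℝ) < n := by exact_mod_cast hjn
      have hterm : ∀ k, |freqVec N (Real.ofDigits a) n k - q k| ≤ C / n := fun k => by
        rw [freqVec_ofDigits ha, div_sub' hn0.ne', abs_div, abs_of_pos hn0]
        gcongr
        exact hC n k
      calc ∑ k, |freqVec N (Real.ofDigits a) n k - q k| ≤ ∑ _k : Fin N, C / n :=
            Finset.sum_le_sum fun k _ => hterm k
        _ = N * C / n := by simp [mul_div_assoc]
        _ < 1 / h := by
          rw [div_lt_div_iff₀ hn0 hh']
          linarith
end

section
/- Fix an integer N ≥ 2. Let T = [c_{m,n}] be a regular linear transformation and let M ∈ ℕ satisfy Σ_{n≥1} |c_{m,n}| < M for all m. Then for every h ∈ ℕ there exists an increasing function ψ : ℕ → ℕ with ψ(n) > n² for all n, such that for every x ∈ 𝕀: if the sequence (Π(x,n))_n has property P_{6Mh,ψ}, then the T-averaged sequence (Π^T(x,m))_m has property P_{h,ψ}. -/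
open Filter Topology

theorem sum_freqVec_le_one (N : ℕ) (x : ℝ) (n : ℕ) : ∑ i, freqVec N x n i ≤ 1 := by
  unfold freqVec
  rw [← Finset.sum_div]
  refine div_le_one_of_le₀ ?_ (Nat.cast_nonneg n)
  rw [← Nat.cast_sum, ← Finset.card_biUnion]
  · refine Nat.cast_le.2 ((Finset.card_le_card (t := Finset.Icc 1 n) ?_).trans (by simp))
    exact Finset.biUnion_subset.2 fun i _ => Finset.filter_subset _ _
  · intro a _ b _ hab
    refine Finset.disjoint_left.2 fun j hj hj' => hab (Fin.ext ?_)
    rw [← (Finset.mem_filter.1 hj).2, (Finset.mem_filter.1 hj').2]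

theorem freqVec_nonneg (N : ℕ) (x : ℝ) (n : ℕ) (i : Fin N) : 0 ≤ freqVec N x n i := by
  unfold freqVec
  positivity

theorem sum_abs_freqVec_sub_le_two (N : ℕ) (x : ℝ) (n : ℕ) {q : Fin N → ℝ}
    (hq : q ∈ stdSimplex ℝ (Fin N)) : ∑ i, |freqVec N x n i - q i| ≤ 2 := by
  calc ∑ i, |freqVec N x n i - q i| ≤ ∑ i, (freqVec N x n i + q i) :=
        Finset.sum_le_sum fun i _ => abs_le.2
          ⟨by linarith [freqVec_nonneg N x n i], by linarith [hq.1 i]⟩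
    _ ≤ 2 := by
        rw [Finset.sum_add_distrib, hq.2]
        linarith [sum_freqVec_le_one N x n]

theorem IsRegularLT.tendsto_column {c : ℕ → ℕ → ℝ} (hc : IsRegularLT c) (k : ℕ) :
    Tendsto (fun m => c m k) atTop (𝓝 0) := by
  refine hc.2 (Pi.single k 1) 0 ?_ _ fun m => ?_
  · refine tendsto_const_nhds.congr' ?_
    filter_upwards [eventually_gt_atTop k] with n hn
    rw [Pi.single_eq_of_ne hn.ne']
  · refine tendsto_const_nhds.congr' ?_
    filter_upwards [eventually_gt_atTop k] with K hK
    rw [Finset.sum_eq_single k (fun b _ hb => by rw [Pi.single_eq_of_ne hb, mul_zero])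
      (fun hk => absurd (Finset.mem_range.2 hK) hk)]
    simp

theorem IsRegularLT.tendsto_tsum_row {c : ℕ → ℕ → ℝ} (hc : IsRegularLT c)
    (hs : ∀ m, Summable (c m)) : Tendsto (fun m => ∑' n, c m n) atTop (𝓝 1) := by
  refine hc.2 (fun _ => 1) 1 tendsto_const_nhds _ fun m => ?_
  simpa [SeriesTo] using (hs m).hasSum.tendsto_sum_nat

/-- A summable row averages a bounded vector sequence to within the weighted average of the
pointwise errors, up to the defect of the row sum. -/
theorem sum_abs_tsum_mul_sub_le {ι : Type*} [Fintype ι] {a : ℕ → ℝ} {v : ℕ → ι → ℝ} {q : ι → ℝ}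
    {B : ℝ} (ha : Summable fun k => |a k|) (hv : ∀ k, ∑ i, |v k i - q i| ≤ B) :
    ∑ i, |∑' k, a k * v k i - q i| ≤
      ∑' k, |a k| * ∑ i, |v k i - q i| + |∑' k, a k - 1| * ∑ i, |q i| := by
  have hle (k : ℕ) (i : ι) : |v k i - q i| ≤ B :=
    (Finset.single_le_sum (f := fun i => |v k i - q i|) (fun _ _ => abs_nonneg _)
      (Finset.mem_univ i)).trans (hv k)
  have hs (i : ι) : Summable fun k => |a k| * |v k i - q i| :=
    Summable.of_nonneg_of_le (fun k => by positivity)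
      (fun k => mul_le_mul_of_nonneg_left (hle k i) (abs_nonneg _)) (ha.mul_right B)
  have hs' (i : ι) : Summable fun k => a k * (v k i - q i) :=
    Summable.of_abs (by simpa only [abs_mul] using hs i)
  have key (i : ι) : |∑' k, a k * v k i - q i| ≤
      ∑' k, |a k| * |v k i - q i| + |∑' k, a k - 1| * |q i| := by
    have h₁ : ∑' k, a k * v k i - q i =
        ∑' k, a k * (v k i - q i) + (∑' k, a k - 1) * q i := by
      have h₂ : ∑' k, a k * v k i = ∑' k, (a k * (v k i - q i) + a k * q i) :=
        tsum_congr fun k => by ring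
      rw [h₂, (hs' i).tsum_add (ha.of_abs.mul_right _), tsum_mul_right]
      ring
    rw [h₁]
    refine (abs_add_le _ _).trans (add_le_add ?_ (abs_mul _ _).le)
    have h₃ := norm_tsum_le_tsum_norm (f := fun k => a k * (v k i - q i))
      (by simpa only [Real.norm_eq_abs, abs_mul] using hs i)
    simpa only [Real.norm_eq_abs, abs_mul] using h₃
  calc ∑ i, |∑' k, a k * v k i - q i|
      ≤ ∑ i, (∑' k, |a k| * |v k i - q i| + |∑' k, a k - 1| * |q i|) :=
        Finset.sum_le_sum fun i _ => key i
    _ = _ := by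
        rw [Finset.sum_add_distrib, ← Finset.mul_sum, ← Summable.tsum_finsetSum fun i _ => hs i]
        simp only [Finset.mul_sum]

/-- A weighted sum of weights bounded by `B`, and by `δ` on `[j, L)`. -/
theorem tsum_abs_mul_le_of_window {a e : ℕ → ℝ} {B δ : ℝ} {j L : ℕ} (hjL : j ≤ L)
    (ha : Summable fun k => |a k|) (he : ∀ k, 0 ≤ e k) (heB : ∀ k, e k ≤ B) (hδ : 0 ≤ δ)
    (heδ : ∀ k, j ≤ k → k < L → e k ≤ δ) :
    ∑' k, |a k| * e k ≤
      (∑ k ∈ Finset.range j, |a k|) * B + (∑' k, |a k|) * δ + (∑' k, |a (k + L)|) * B := by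
  have hs : Summable fun k => |a k| * e k :=
    Summable.of_nonneg_of_le (fun k => mul_nonneg (abs_nonneg _) (he k))
      (fun k => mul_le_mul_of_nonneg_left (heB k) (abs_nonneg _)) (ha.mul_right B)
  have hsL := (summable_nat_add_iff L).2 hs
  have haL := (summable_nat_add_iff L).2 ha
  rw [← hs.sum_add_tsum_nat_add L, ← Finset.sum_range_add_sum_Ico _ hjL, Finset.sum_mul,
    ← tsum_mul_right (a := B)]
  refine add_le_add (add_le_add ?_ ?_) ?_
  · exact Finset.sum_le_sum fun k _ => mul_le_mul_of_nonneg_left (heB k) (abs_nonneg _)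
  · calc ∑ k ∈ Finset.Ico j L, |a k| * e k ≤ ∑ k ∈ Finset.Ico j L, |a k| * δ :=
          Finset.sum_le_sum fun k hk => mul_le_mul_of_nonneg_left
            (heδ k (Finset.mem_Ico.1 hk).1 (Finset.mem_Ico.1 hk).2) (abs_nonneg _)
      _ ≤ _ := by
          rw [← Finset.sum_mul]
          exact mul_le_mul_of_nonneg_right (ha.sum_le_tsum _ fun k _ => abs_nonneg _) hδ
  · exact hsL.tsum_le_tsum (fun k => mul_le_mul_of_nonneg_left (heB _) (abs_nonneg _))
      (haL.mul_right B)

theorem exists_strictMono_sq_lt_of_eventually {P : ℕ → ℕ → Prop}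
    (hP : ∀ n, ∀ᶠ r in atTop, P n r) :
    ∃ ψ : ℕ → ℕ, StrictMono ψ ∧ (∀ n, n ^ 2 < ψ n) ∧ ∀ n, P n (ψ n) := by
  choose g hg using fun n => eventually_atTop.1 (hP n)
  refine ⟨fun n => n ^ 2 + 1 + ∑ k ∈ Finset.range (n + 1), g k, ?_, fun n => ?_, fun n => ?_⟩
  · refine strictMono_nat_of_lt_succ fun n => ?_
    rw [Finset.sum_range_succ _ (n + 1)]
    have h₁ : n ^ 2 < (n + 1) ^ 2 := Nat.pow_lt_pow_left n.lt_succ_self two_ne_zero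
    omega
  · exact Nat.lt_of_lt_of_le (Nat.lt_succ_self _) (Nat.le_add_right _ _)
  · exact hg n _ (le_add_left
      (Finset.single_le_sum (fun _ _ => Nat.zero_le _) (Finset.self_mem_range_succ n)))

/-- The growth function controls both the heads and the tails of the rows of a regular
transformation. -/
theorem IsRegularLT.exists_growth {c : ℕ → ℕ → ℝ} (hc : IsRegularLT c) {ε : ℝ}
    (hε : 0 < ε) :
    ∃ ψ : ℕ → ℕ, StrictMono ψ ∧ (∀ n, n ^ 2 < ψ n) ∧
      ∀ j, (∀ n, ψ j ≤ n → ∑ k ∈ Finset.range j, |c n k| < ε) ∧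
        ∀ n ≤ j, ∑' k, |c n (k + ψ j)| < ε := by
  refine exists_strictMono_sq_lt_of_eventually (P := fun j r =>
    (∀ n, r ≤ n → ∑ k ∈ Finset.range j, |c n k| < ε) ∧
      ∀ n ≤ j, ∑' k, |c n (k + r)| < ε) fun j => ?_
  refine Eventually.and ?_ ((Set.finite_Iic j).eventually_all.2 fun n _ => ?_)
  · have h₁ : Tendsto (fun n => ∑ k ∈ Finset.range j, |c n k|) atTop (𝓝 0) := by
      simpa using tendsto_finsetSum (Finset.range j) fun k _ => (hc.tendsto_column k).abs
    exact eventually_forall_ge_atTop.2 (h₁.eventually_lt_const hε)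
  · exact (tendsto_sum_nat_add fun k => |c n k|).eventually_lt_const hε

/-- Let `T = [c_{m,n}]` be a regular linear transformation with
`Σ_n |c_{m,n}| < M` for all `m`. For every `h ≥ 1` there is an increasing `ψ : ℕ → ℕ`
with `ψ(n) > n²` such that for every `x ∈ 𝕀`: if `(Π(x,n))_n` has property `P_{6Mh,ψ}`
then `(Π^T(x,m))_m` has property `P_{h,ψ}`. -/
theorem exists_psi_propP_transfer (N : ℕ) (hN : 2 ≤ N) (c : ℕ → ℕ → ℝ)
    (hc : IsRegularLT c) (M : ℕ)
    (hM : ∀ m, Summable (fun n => |c m n|) ∧ ∑' n, |c m n| < (M : ℝ))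
    (h : ℕ) (hh : 0 < h) :
    ∃ ψ : ℕ → ℕ, StrictMono ψ ∧ (∀ n, n ^ 2 < ψ n) ∧
      ∀ x ∈ Iset N, PropP N (6 * M * h) ψ (fun n => freqVec N x n) →
        PropP N h ψ (freqT N c x) := by
  have hs m := (hM m).1
  have hh' : (0 : ℝ) < h := Nat.cast_pos.2 hh
  have hM0 : (0 : ℝ) < M := (tsum_nonneg fun k => abs_nonneg (c 0 k)).trans_lt (hM 0).2
  have hε : (0 : ℝ) < 1 / (12 * h) := by positivity
  obtain ⟨ψ, hψ, hψ2, hψc⟩ := hc.exists_growth hε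
  refine ⟨ψ, hψ, hψ2, fun x _ hx i m q hq => ?_⟩
  obtain ⟨n₀, hn₀⟩ := eventually_atTop.1 ((tendsto_order.1
    ((hc.tendsto_tsum_row fun m => (hs m).of_abs).sub_const 1).abs).2 (1 / (12 * h))
      (by simpa using hε))
  obtain ⟨j, hij, -, hj⟩ := hx (max i (max n₀ h)) (m + 2) q hq
  simp only [max_le_iff] at hij
  have hjψ : j ≤ ψ j := hψ.le_apply
  refine ⟨ψ j, by omega, ?_, fun n hn hnm => ?_⟩
  · have h₁ : (h : ℝ) ≤ ψ j := by exact_mod_cast (hij.2.2.trans hjψ)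
    have h₂ : (ψ j : ℝ) ^ 2 ≤ ψ (ψ j) := by exact_mod_cast (hψ2 (ψ j)).le
    rw [div_le_div_iff₀ (by nlinarith) hh']
    nlinarith
  · set p := ψ^[m] (ψ j)
    have hp : ψ^[m + 2] j = ψ p := by
      rw [Function.iterate_succ_apply, Function.iterate_succ_apply']
    have hjL : j ≤ ψ p := hjψ.trans (hn.trans (hnm.trans hψ.le_apply))
    have hδ : (0 : ℝ) ≤ 1 / ((6 * M * h : ℕ) : ℝ) := by positivity
    have hB k := sum_abs_freqVec_sub_le_two N x k hq.1
    have h₁ := sum_abs_tsum_mul_sub_le (hs n) hB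
    have h₂ := tsum_abs_mul_le_of_window (e := fun k => ∑ i, |freqVec N x k i - q i|) hjL (hs n)
      (fun k => Finset.sum_nonneg fun _ _ => abs_nonneg _) hB hδ
      (fun k hk hk' => (hj k hk (hp ▸ hk'.le)).le)
    have hq1 : ∑ i, |q i| = 1 := by
      rw [← hq.1.2]
      exact Finset.sum_congr rfl fun i _ => abs_of_nonneg (hq.1.1 i)
    have h₃ := hn₀ n (by omega)
    have h₄ := (hψc j).1 n hn
    have h₅ := (hψc p).2 n hnm
    have h₆ : (∑' k, |c n k|) * (1 / ((6 * M * h : ℕ) : ℝ)) ≤ 2 * (1 / (12 * h)) := by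
      calc _ ≤ (M : ℝ) * (1 / ((6 * M * h : ℕ) : ℝ)) :=
            mul_le_mul_of_nonneg_right (hM n).2.le hδ
        _ = _ := by
            push_cast
            field_simp
            norm_num
    have h₇ : 1 / (h : ℝ) = 12 * (1 / (12 * h)) := by field_simp
    rw [hq1] at h₁
    unfold freqT
    linarith
end

section
/- Fix an integer N ≥ 2. Let (x_m)_m be a sequence in ℝ^N such that for every h ∈ ℕ there exists an increasing function ψ_h : ℕ → ℕ with ψ_h(n) > n² for all n for which (x_m)_m has property P_{h,ψ_h}. Then every point p of the simplex Δ_N is an accumulation point of (x_m)_m with respect to the ℓ¹ norm. -/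
open Filter Topology

/-- Rational probability vectors with all coordinates positive approximate every point of the
simplex, so `𝔻` is ℓ¹-dense in `Δ_N`. -/
theorem exists_mem_Dset_sum_abs_sub_lt {N : ℕ} (hN : 2 ≤ N) {p : Fin N → ℝ}
    (hp : p ∈ stdSimplex ℝ (Fin N)) {ε : ℝ} (hε : 0 < ε) :
    ∃ q ∈ Dset N, ∑ k, |q k - p k| < ε := by
  have : Nonempty (Fin N) := ⟨⟨0, by omega⟩⟩
  let a : ℕ → Fin N → ℕ := fun n i => ⌊p i * n⌋₊ + 1
  let q : ℕ → Fin N → ℝ := fun n i => (a n i : ℝ) / ∑ k, (a n k : ℝ)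
  have ha : ∀ n i, (0 : ℝ) < a n i := fun n i => Nat.cast_pos.2 (Nat.succ_pos _)
  have hS : ∀ n, (0 : ℝ) < ∑ k, (a n k : ℝ) := fun n =>
    Finset.sum_pos (fun k _ => ha n k) Finset.univ_nonempty
  have hq : ∀ n i, 0 < q n i := fun n i => div_pos (ha n i) (hS n)
  have hmem : ∀ n, q n ∈ Dset N := by
    intro n
    refine ⟨⟨fun i => (hq n i).le, ?_⟩, fun i => ⟨(a n i : ℚ) / ∑ k, (a n k : ℚ), ?_⟩, ?_, ?_⟩
    · simp only [q, ← Finset.sum_div]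
      exact div_self (hS n).ne'
    · simp [q]
    · intro h
      have h1 := hq n ⟨N - 1, by omega⟩
      rw [h] at h1
      simp [show N - 1 ≠ 0 by omega] at h1
    · intro h
      have h1 := hq n ⟨0, by omega⟩
      rw [h] at h1
      simp [show 0 ≠ N - 1 by omega] at h1
  have hlim : ∀ i, Tendsto (fun n : ℕ => (a n i : ℝ) / n) atTop (𝓝 (p i)) := by
    intro i
    have h1 := ((tendsto_nat_floor_mul_div_atTop (hp.1 i)).comp
      (tendsto_natCast_atTop_atTop (R := ℝ))).add (tendsto_one_div_atTop_nhds_zero_nat (𝕜 := ℝ))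
    simpa [a, Function.comp_def, add_div] using h1
  have hsum : Tendsto (fun n : ℕ => (∑ k, (a n k : ℝ)) / n) atTop (𝓝 1) := by
    rw [← hp.2]
    simpa only [Finset.sum_div] using tendsto_finsetSum Finset.univ fun i _ => hlim i
  have hqlim : ∀ i, Tendsto (fun n => q n i) atTop (𝓝 (p i)) := by
    intro i
    have h1 := (hlim i).div hsum one_ne_zero
    rw [div_one] at h1
    refine h1.congr' ?_
    filter_upwards [eventually_gt_atTop 0] with n hn
    exact div_div_div_cancel_right₀ (Nat.cast_pos.2 hn).ne' _ _
  have hdist : Tendsto (fun n => ∑ k, |q n k - p k|) atTop (𝓝 0) := by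
    simpa using tendsto_finsetSum Finset.univ fun i _ => ((hqlim i).sub_const (p i)).abs
  obtain ⟨n, hn⟩ := (hdist.eventually_lt_const hε).exists
  exact ⟨q n, hmem n, hn⟩

/-- If a sequence `(x_m)_m` in `ℝ^N` has, for every `h ≥ 1`, property
`P_{h,ψ_h}` for some increasing `ψ_h` with `ψ_h(n) > n²`, then every point of the simplex
`Δ_N` is an ℓ¹-accumulation point of `(x_m)_m`. -/
theorem accPt_of_propP (N : ℕ) (hN : 2 ≤ N) (v : ℕ → Fin N → ℝ)
    (hv : ∀ h : ℕ, 0 < h → ∃ ψ : ℕ → ℕ, StrictMono ψ ∧ (∀ n, n ^ 2 < ψ n) ∧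
      PropP N h ψ v) :
    ∀ p ∈ stdSimplex ℝ (Fin N), IsAccPt1 N v p := by
  intro p hp
  have hfreq : ∀ u : ℕ, ∃ᶠ n in atTop, ∑ k, |v n k - p k| < 2 / ((u : ℝ) + 1) := by
    intro u
    rw [frequently_atTop]
    intro i
    obtain ⟨ψ, -, -, hψ⟩ := hv (u + 1) u.succ_pos
    obtain ⟨q, hq, hqp⟩ := exists_mem_Dset_sum_abs_sub_lt hN hp (Nat.one_div_pos_of_nat (n := u))
    obtain ⟨j, hij, -, hj⟩ := hψ i 0 q hq
    have hvq := hj j le_rfl le_rfl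
    push_cast at hvq
    refine ⟨j, hij, ?_⟩
    calc ∑ k, |v j k - p k| ≤ ∑ k, (|v j k - q k| + |q k - p k|) :=
          Finset.sum_le_sum fun k _ => abs_sub_le _ _ _
      _ = ∑ k, |v j k - q k| + ∑ k, |q k - p k| := Finset.sum_add_distrib
      _ < 1 / ((u : ℝ) + 1) + 1 / ((u : ℝ) + 1) := add_lt_add hvq hqp
      _ = 2 / ((u : ℝ) + 1) := by ring
  obtain ⟨φ, hφ, hlt⟩ := extraction_forall_of_frequently hfreq
  refine ⟨φ, hφ, squeeze_zero (fun u => Finset.sum_nonneg fun k _ => abs_nonneg _)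
    (fun u => (hlt u).le) ?_⟩
  simpa [div_eq_mul_inv] using (tendsto_one_div_add_atTop_nhds_zero_nat (𝕜 := ℝ)).const_mul 2
end

section
/- (Silverman–Toeplitz theorem) Let T = [c_{m,n}] be an ℕ×ℕ real matrix which is a linear transformation, i.e., for every convergent real sequence (s_n) and every m the series t_m = Σ_{n≥1} c_{m,n} s_n converges. Then T is regular (t_m → l whenever s_n → l) if and only if the following three conditions hold: (1) there exists M ∈ ℕ such that Σ_{n≥1} |c_{m,n}| < M for all m ∈ ℕ; (2) for every n ∈ ℕ, lim_{m→∞} c_{m,n} = 0; (3) lim_{m→∞} Σ_{n≥1} c_{m,n} = 1. -/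
open Filter Topology

open scoped ZeroAtInfty

/-- The sequence `f`, tending to zero, as an element of `C₀(ℕ, ℝ)`. -/
def zeroAtInftyOfTendsto (f : ℕ → ℝ) (hf : Tendsto f atTop (𝓝 0)) : C₀(ℕ, ℝ) :=
  ⟨⟨f, continuous_of_discreteTopology⟩, by
    simpa [cocompact_eq_cofinite, Nat.cofinite_eq_atTop] using hf⟩

theorem ZeroAtInftyContinuousMap.abs_apply_le_norm (f : C₀(ℕ, ℝ)) (n : ℕ) : |f n| ≤ ‖f‖ := by
  rw [← ZeroAtInftyContinuousMap.norm_toBCF_eq_norm]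
  exact f.toBCF.norm_coe_le_norm n

theorem ZeroAtInftyContinuousMap.tendsto_atTop (f : C₀(ℕ, ℝ)) : Tendsto f atTop (𝓝 0) := by
  have h := f.zero_at_infty'
  simpa [cocompact_eq_cofinite, Nat.cofinite_eq_atTop] using h

/-- Evaluation at `n` as a continuous linear functional on `C₀(ℕ, ℝ)`. -/
noncomputable def zeroAtInftyEval (n : ℕ) : C₀(ℕ, ℝ) →L[ℝ] ℝ :=
  LinearMap.mkContinuous
    { toFun := fun f => f n
      map_add' := fun _ _ => rfl
      map_smul' := fun _ _ => rfl } 1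
    (fun f => by simpa using f.abs_apply_le_norm n)

/-- A series that converges against every null sequence defines a continuous functional. -/
theorem exists_clm_seriesTo (a : ℕ → ℝ)
    (ha : ∀ s : ℕ → ℝ, Tendsto s atTop (𝓝 0) → ∃ t, SeriesTo (fun n => a n * s n) t) :
    ∃ φ : C₀(ℕ, ℝ) →L[ℝ] ℝ, ∀ f : C₀(ℕ, ℝ), SeriesTo (fun n => a n * f n) (φ f) := by
  choose t ht using fun f : C₀(ℕ, ℝ) => ha f f.tendsto_atTop
  let g : ℕ → C₀(ℕ, ℝ) →L[ℝ] ℝ := fun K => ∑ n ∈ Finset.range K, a n • zeroAtInftyEval n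
  have hg : ∀ K f, g K f = ∑ n ∈ Finset.range K, a n * f n := fun K f => by
    simp [g, zeroAtInftyEval]
  have hlim : Tendsto (fun K f => g K f) atTop (𝓝 t) := by
    rw [tendsto_pi_nhds]
    intro f
    simpa only [hg, SeriesTo] using ht f
  exact ⟨continuousLinearMapOfTendsto g hlim, ht⟩

/-- The partial absolute sums are bounded by the norm of the functional. -/
theorem sum_abs_le_norm_of_seriesTo {a : ℕ → ℝ} {φ : C₀(ℕ, ℝ) →L[ℝ] ℝ}
    (hφ : ∀ f : C₀(ℕ, ℝ), SeriesTo (fun n => a n * f n) (φ f)) (K : ℕ) :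
    ∑ n ∈ Finset.range K, |a n| ≤ ‖φ‖ := by
  let s : ℕ → ℝ := fun n => if n < K then (SignType.sign (a n) : ℝ) else 0
  have hs : Tendsto s atTop (𝓝 0) :=
    tendsto_const_nhds.congr' <| (eventually_ge_atTop K).mono fun n hn => by simp [s, hn]
  let f := zeroAtInftyOfTendsto s hs
  have hfs : ∀ n, f n = s n := fun _ => rfl
  have hf : ‖f‖ ≤ 1 := by
    rw [← ZeroAtInftyContinuousMap.norm_toBCF_eq_norm,
      BoundedContinuousFunction.norm_le zero_le_one]
    intro n
    change |s n| ≤ 1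
    rcases lt_trichotomy (a n) 0 with h | h | h <;> by_cases hn : n < K <;> simp [s, h, hn]
  have hsum : SeriesTo (fun n => a n * f n) (∑ n ∈ Finset.range K, |a n|) := by
    refine tendsto_const_nhds.congr' <| (eventually_ge_atTop K).mono fun L hL => ?_
    refine Eq.trans (Finset.sum_congr rfl fun n hn => ?_)
      (Finset.sum_subset (Finset.range_mono hL) fun n _ hn => ?_)
    · simp [hfs, s, Finset.mem_range.1 hn, self_mul_sign]
    · simp only [Finset.mem_range] at hn
      simp [hfs, s, hn]
  rw [tendsto_nhds_unique hsum (hφ f)]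
  calc φ f ≤ ‖φ f‖ := le_abs_self _
    _ ≤ ‖φ‖ * ‖f‖ := φ.le_opNorm f
    _ ≤ ‖φ‖ := mul_le_of_le_one_right φ.opNorm_nonneg hf

theorem IsRegularLT.exists_bound {c : ℕ → ℕ → ℝ} (h : IsRegularLT c) :
    ∃ C : ℝ, ∀ m K, ∑ n ∈ Finset.range K, |c m n| ≤ C := by
  choose φ hφ using fun m => exists_clm_seriesTo (c m) fun s hs => h.1 s ⟨0, hs⟩ m
  obtain ⟨C, hC⟩ := banach_steinhaus (g := φ) fun f => by
    have hb := Metric.isBounded_range_of_tendsto _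
      (h.2 f 0 f.tendsto_atTop (fun m => φ m f) fun m => hφ m f)
    obtain ⟨C, hC⟩ := hb.exists_norm_le
    exact ⟨C, fun m => hC _ ⟨m, rfl⟩⟩
  exact ⟨C, fun m K => (sum_abs_le_norm_of_seriesTo (hφ m) K).trans (hC m)⟩

/-- A matrix with bounded absolute row sums and null columns preserves null sequences. -/
theorem tendsto_zero_of_row_bound {c : ℕ → ℕ → ℝ} {M : ℝ}
    (hM : ∀ m K, ∑ n ∈ Finset.range K, |c m n| ≤ M)
    (hcol : ∀ n, Tendsto (fun m => c m n) atTop (𝓝 0))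
    {u t : ℕ → ℝ} (hu : Tendsto u atTop (𝓝 0))
    (ht : ∀ m, SeriesTo (fun n => c m n * u n) (t m)) :
    Tendsto t atTop (𝓝 0) := by
  have hM0 : 0 ≤ M := by simpa using hM 0 0
  rw [Metric.tendsto_atTop]
  intro ε hε
  set δ := ε / (2 * (M + 1)) with hδ
  have hδ0 : 0 < δ := by positivity
  have hδM : δ * M < ε / 2 := by
    have : δ * (M + 1) = ε / 2 := by rw [hδ]; field_simp
    linarith
  obtain ⟨N, hN⟩ := (Metric.tendsto_atTop.1 hu) δ hδ0
  have hhead : Tendsto (fun m => ∑ n ∈ Finset.range N, |c m n| * |u n|) atTop (𝓝 0) := by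
    have := tendsto_finsetSum (Finset.range N) fun n _ => ((hcol n).abs.mul_const |u n|)
    simpa using this
  obtain ⟨m₀, hm₀⟩ := eventually_atTop.1 (hhead.eventually_lt_const (half_pos hε))
  refine ⟨m₀, fun m hm => ?_⟩
  have hbound : ∀ K, |∑ n ∈ Finset.range K, c m n * u n|
      ≤ ∑ n ∈ Finset.range N, |c m n| * |u n| + δ * M := by
    intro K
    calc |∑ n ∈ Finset.range K, c m n * u n|
        ≤ ∑ n ∈ Finset.range K, |c m n| * |u n| := by
          simpa only [abs_mul] using
            Finset.abs_sum_le_sum_abs (fun n => c m n * u n) (Finset.range K)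
      _ ≤ ∑ n ∈ Finset.range K, ((if n < N then |c m n| * |u n| else 0) + δ * |c m n|) := by
          refine Finset.sum_le_sum fun n _ => ?_
          split_ifs with hn
          · exact le_add_of_nonneg_right (by positivity)
          · have : |u n| < δ := by simpa using hN n (not_lt.1 hn)
            nlinarith [abs_nonneg (c m n)]
      _ ≤ _ := by
          rw [Finset.sum_add_distrib, ← Finset.mul_sum, ← Finset.sum_filter]
          refine add_le_add (Finset.sum_le_sum_of_subset_of_nonneg ?_ fun _ _ _ => by positivity)
            (mul_le_mul_of_nonneg_left (hM m K) hδ0.le)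
          intro n hn
          simpa using (Finset.mem_filter.1 hn).2
  have hle := le_of_tendsto (ht m).abs (Eventually.of_forall hbound)
  rw [Real.dist_0_eq_abs]
  linarith [hm₀ m hm]

/-- Silverman–Toeplitz theorem. A linear transformation `T = [c_{m,n}]`
is regular iff (1) the absolute row sums are uniformly bounded by some `M ∈ ℕ`,
(2) each column tends to `0`, and (3) the row sums tend to `1`. -/
theorem silverman_toeplitz (c : ℕ → ℕ → ℝ) (hc : IsLinTrans c) :
    IsRegularLT c ↔
      (∃ M : ℕ, ∀ m, Summable (fun n => |c m n|) ∧ ∑' n, |c m n| < (M : ℝ)) ∧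
      (∀ n, Tendsto (fun m => c m n) atTop (𝓝 0)) ∧
      (∃ r : ℕ → ℝ, (∀ m, SeriesTo (fun n => c m n) (r m)) ∧
        Tendsto r atTop (𝓝 1)) := by
  constructor
  · intro h
    refine ⟨?_, fun n => ?_, ?_⟩
    · obtain ⟨C, hC⟩ := h.exists_bound
      obtain ⟨M, hM⟩ := exists_nat_gt C
      exact ⟨M, fun m => ⟨summable_of_sum_range_le (fun _ => abs_nonneg _) (hC m),
        (Real.tsum_le_of_sum_range_le (fun _ => abs_nonneg _) (hC m)).trans_lt hM⟩⟩
    · refine h.2 (Pi.single n 1) 0 ?_ _ fun m => ?_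
      · exact tendsto_const_nhds.congr' <| (eventually_gt_atTop n).mono fun k hk => by
          simp [hk.ne']
      · refine tendsto_const_nhds.congr' <| (eventually_gt_atTop n).mono fun K hK => ?_
        simp [Pi.single_apply, hK]
    · choose r hr using hc (fun _ => 1) ⟨1, tendsto_const_nhds⟩
      exact ⟨r, by simpa using hr, h.2 _ 1 tendsto_const_nhds r hr⟩
  · rintro ⟨⟨M, hM⟩, hcol, r, hr, hr1⟩
    refine ⟨hc, fun s l hs t ht => ?_⟩
    have hrow : ∀ m K, ∑ n ∈ Finset.range K, |c m n| ≤ M := fun m K =>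
      ((hM m).1.sum_le_tsum _ fun _ _ => abs_nonneg _).trans (hM m).2.le
    have hu : Tendsto (fun n => s n - l) atTop (𝓝 0) := by simpa using hs.sub_const l
    have h0 : Tendsto (fun m => t m - r m * l) atTop (𝓝 0) := by
      refine tendsto_zero_of_row_bound hrow hcol hu fun m => ?_
      have h := Tendsto.sub (ht m) (Tendsto.mul_const l (hr m))
      simpa only [SeriesTo, mul_sub, Finset.sum_sub_distrib, Finset.sum_mul] using h
    simpa using h0.add (hr1.mul_const l)
end
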